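/- Let 0 < s < 2 and set C(s) = 2^{-s}·(s/2)·(1 + s/2)·Γ(1 − s/2)·ζ(1 − s/2), where ζ is the (analytically continued) Riemann zeta function; note C(s) < 0. Then there exists N₀ = N₀(s) such that for every integer N ≥ N₀ there exist N distinct points x₁, …, x_N on the unit sphere S² ⊂ ℝ³ with Σ_{i≠j} |x_i − x_j|^{-s} ≤ (2^{1−s}/(2−s))·N² + C(s)·N^{1+s/2}. In particular the minimal Riesz s-energy satisfies 𝓔_s(N) − (2^{1−s}/(2−s))N² ≤ C(s)·N^{1+s/2} for all N ≥ N₀. -/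

import Mathlib

open Real

/-- The set of Riesz `s`-energies of `N`-tuples of distinct points on the unit sphere
`S² ⊂ ℝ³`; its infimum is the minimal Riesz `s`-energy `𝓔_s(N)`. -/
noncomputable def rieszEnergies (s : ℝ) (N : ℕ) : Set ℝ :=
  {e | ∃ x : Fin N → EuclideanSpace ℝ (Fin 3),
    (∀ i, ‖x i‖ = 1) ∧ Function.Injective x ∧
    e = ∑ i : Fin N, ∑ j : Fin N, if i = j then 0 else ‖x i - x j‖ ^ (-s)}

/-- The second-order constant `C(s) = 2^{-s}(s/2)(1+s/2)Γ(1−s/2)ζ(1−s/2)`. -/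
noncomputable def Cconst (s : ℝ) : ℝ :=
  2 ^ (-s) * (s/2) * (1 + s/2) * Real.Gamma (1 - s/2) * (riemannZeta ((1 - s/2 : ℝ) : ℂ)).re

namespace RB

noncomputable def vterm (n : ℕ) (s : ℂ) : ℂ :=
  (s - 1) * ((n:ℂ)+1) ^ (-s) - ((n:ℂ)+1) ^ (1-s) + ((n:ℂ)+1+1) ^ (1-s)

lemma vterm_bound (n : ℕ) (s : ℂ) (hs : 0 < s.re) :
    ‖vterm n s‖ ≤ ‖s - 1‖ * ‖s‖ * ((n:ℝ)+1) ^ (-s.re - 1) := by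
  have hn : (0:ℝ) < (n:ℝ)+1 := by positivity
  have hd : ∀ c : ℂ, c ≠ 0 → ∀ x : ℝ, 0 < x → HasDerivAt (fun y : ℝ => (y:ℂ) ^ c) (c * (x:ℂ)^(c-1)) x := by
    intro c hc x hx
    exact hasDerivAt_ofReal_cpow_const hx.ne' hc
  have hs0 : s ≠ 0 := by
    rintro rfl; simp at hs
  have h1 : ∀ x ∈ Set.Icc ((n:ℝ)+1) ((n:ℝ)+1+1),
      ‖(x:ℂ)^(-s) - (((n:ℝ)+1:ℝ):ℂ)^(-s)‖ ≤ ‖s‖ * ((n:ℝ)+1) ^ (-s.re - 1) * (x - ((n:ℝ)+1)) := by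
    apply norm_image_sub_le_of_norm_deriv_le_segment' (f' := fun x : ℝ => (-s) * (x:ℂ)^(-s-1))
    · intro x hx
      exact (hd (-s) (neg_ne_zero.mpr hs0) x (hn.trans_le hx.1)).hasDerivWithinAt
    · intro x hx
      have hx0 : 0 < x := hn.trans_le hx.1
      rw [norm_mul, norm_neg, Complex.norm_cpow_eq_rpow_re_of_pos hx0]
      simp only [Complex.sub_re, Complex.neg_re, Complex.one_re]
      exact mul_le_mul_of_nonneg_left (Real.rpow_le_rpow_of_nonpos hn hx.1 (by linarith)) (norm_nonneg _)
  by_cases hs1 : s = 1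
  · subst hs1; simp [vterm]
  have hs1' : (1 - s) ≠ 0 := sub_ne_zero.mpr (Ne.symm hs1)
  have h2 := norm_image_sub_le_of_norm_deriv_le_segment' (a := (n:ℝ)+1) (b := (n:ℝ)+1+1)
    (f := fun x : ℝ => (s-1) * ((((n:ℝ)+1:ℝ):ℂ)^(-s)) * ((x:ℂ) - (((n:ℝ)+1:ℝ):ℂ)) + (x:ℂ)^(1-s))
    (f' := fun x : ℝ => (s-1) * ((((n:ℝ)+1:ℝ):ℂ)^(-s)) * 1 + (1-s) * (x:ℂ)^(1-s-1))
    (C := ‖s-1‖ * (‖s‖ * ((n:ℝ)+1) ^ (-s.re - 1))) ?_ ?_ ((n:ℝ)+1+1) (by constructor <;> linarith)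
  · simp only [vterm]
    have e : (s - 1) * ((n:ℂ)+1) ^ (-s) - ((n:ℂ)+1) ^ (1-s) + ((n:ℂ)+1+1) ^ (1-s) =
      (s-1) * ((((n:ℝ)+1:ℝ):ℂ)^(-s)) * (((((n:ℝ)+1+1:ℝ):ℂ)) - (((n:ℝ)+1:ℝ):ℂ)) + ((((n:ℝ)+1+1:ℝ):ℂ))^(1-s)
      - ((s-1) * ((((n:ℝ)+1:ℝ):ℂ)^(-s)) * (((((n:ℝ)+1:ℝ):ℂ)) - (((n:ℝ)+1:ℝ):ℂ)) + ((((n:ℝ)+1:ℝ):ℂ))^(1-s)) := by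
      push_cast; ring
    rw [e]
    refine h2.trans (le_of_eq ?_)
    ring
  · intro x hx
    have := (((Complex.ofRealCLM.hasDerivAt (x := x)).sub_const (((n:ℝ)+1:ℝ):ℂ)).const_mul ((s-1) * ((((n:ℝ)+1:ℝ):ℂ)^(-s)))).add
      (hd (1-s) hs1' x (hn.trans_le hx.1))
    exact this.hasDerivWithinAt
  · intro x hx
    have e : (s-1) * ((((n:ℝ)+1:ℝ):ℂ)^(-s)) * 1 + (1-s) * (x:ℂ)^(1-s-1)
      = -(s-1) * ((x:ℂ)^(-s) - (((n:ℝ)+1:ℝ):ℂ)^(-s)) := by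
      rw [show 1 - s - 1 = -s by ring]; ring
    rw [e, norm_mul, norm_neg]
    gcongr
    refine (h1 x ⟨hx.1, hx.2.le⟩).trans ?_
    have : x - ((n:ℝ)+1) ≤ 1 := by linarith [hx.2]
    have h0 : 0 ≤ ‖s‖ * ((n:ℝ)+1) ^ (-s.re - 1) := by positivity
    nlinarith

lemma summable_aux {σ : ℝ} (hσ : 0 < σ) : Summable (fun n : ℕ => ((n:ℝ)+1) ^ (-σ - 1)) := by
  have := (summable_nat_add_iff 1).mpr (Real.summable_nat_rpow.mpr (show -σ-1 < -1 by linarith))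
  simpa using this

lemma vsum_diff : DifferentiableOn ℂ (fun s => ∑' n, vterm n s) {s : ℂ | 0 < s.re} := by
  have hopen : IsOpen {s : ℂ | 0 < s.re} := isOpen_lt continuous_const Complex.continuous_re
  intro s0 hs0
  have hs0' : 0 < s0.re := hs0
  set V : Set ℂ := {s : ℂ | s0.re/2 < s.re} ∩ Metric.ball s0 1 with hV
  have hVo : IsOpen V := (isOpen_lt continuous_const Complex.continuous_re).inter Metric.isOpen_ball
  have hmem : s0 ∈ V := ⟨by show s0.re/2 < s0.re; linarith, Metric.mem_ball_self one_pos⟩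
  have : DifferentiableOn ℂ (fun s => ∑' n, vterm n s) V := by
    apply Complex.differentiableOn_tsum_of_summable_norm (u := fun n : ℕ => ((‖s0‖+2) * (‖s0‖+1)) * ((n:ℝ)+1) ^ (-(s0.re/2) - 1))
    · exact (summable_aux (by positivity)).mul_left _
    · intro n s hs
      have hn1 : ((n:ℂ)+1) ≠ 0 := by exact_mod_cast Nat.succ_ne_zero n
      have hn2 : ((n:ℂ)+1+1) ≠ 0 := by exact_mod_cast Nat.succ_ne_zero (n+1)
      apply DifferentiableAt.differentiableWithinAt
      unfold vterm
      refine DifferentiableAt.add (DifferentiableAt.sub ?_ ?_) ?_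
      · exact (by fun_prop : DifferentiableAt ℂ (fun s : ℂ => s - 1) s).mul
          (DifferentiableAt.const_cpow (by fun_prop) (Or.inl hn1))
      · exact DifferentiableAt.const_cpow (by fun_prop) (Or.inl hn1)
      · exact DifferentiableAt.const_cpow (by fun_prop) (Or.inl hn2)
    · exact hVo
    · intro n s hs
      have hsr : s0.re/2 < s.re := hs.1
      have hball : ‖s - s0‖ < 1 := by simpa [dist_eq_norm] using hs.2
      have hns : ‖s‖ ≤ ‖s0‖ + 1 := by
        have := norm_sub_norm_le s s0; linarith
      have hns1 : ‖s - 1‖ ≤ ‖s0‖ + 2 := by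
        have := norm_sub_le s 1; simp at this; linarith
      refine (vterm_bound n s (by linarith)).trans ?_
      have : ((n:ℝ)+1) ^ (-s.re - 1) ≤ ((n:ℝ)+1) ^ (-(s0.re/2) - 1) :=
        Real.rpow_le_rpow_of_exponent_le (by linarith [Nat.cast_nonneg (α := ℝ) n]) (by linarith)
      gcongr
  exact ((this s0 hmem).differentiableAt (hVo.mem_nhds hmem)).differentiableWithinAt

lemma zeta1_of_one_lt (s : ℂ) (hs : 1 < s.re) : riemannZeta₁ s = 1 + ∑' n, vterm n s := by
  have hs1 : s ≠ 1 := by rintro rfl; simp at hs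
  have h1 := riemannZeta_eq_inv_sub_mul hs1
  have hsub : s - 1 ≠ 0 := sub_ne_zero.mpr hs1
  have h2 : riemannZeta₁ s = (s-1) * riemannZeta s := by rw [h1]; field_simp
  have hz := zeta_eq_tsum_one_div_nat_add_one_cpow hs
  have hsum : Summable (fun n : ℕ => 1 / ((n:ℂ)+1) ^ s) := by
    have := (summable_nat_add_iff 1).mpr (Complex.summable_one_div_nat_cpow.mpr hs)
    simpa using this
  have hs2 : HasSum (fun n : ℕ => (s-1) * ((n:ℂ)+1)^(-s)) ((s-1) * riemannZeta s) := by
    rw [hz]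
    have e : (fun n : ℕ => (s-1) * ((n:ℂ)+1)^(-s)) = (fun n : ℕ => (s-1) * (1 / ((n:ℂ)+1)^s)) := by
      funext n; rw [Complex.cpow_neg, one_div]
    rw [e]
    exact hsum.hasSum.mul_left (s-1)
  have ht : HasSum (fun n : ℕ => ((n:ℂ)+1) ^ (1-s) - ((n:ℂ)+1+1) ^ (1-s)) 1 := by
    have hlim : Filter.Tendsto (fun n : ℕ => ((n:ℂ)+1) ^ (1-s)) Filter.atTop (nhds 0) := by
      rw [tendsto_zero_iff_norm_tendsto_zero]
      have : Filter.Tendsto (fun n : ℕ => ((n:ℝ)+1) ^ (-(s.re-1))) Filter.atTop (nhds 0) :=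
        (tendsto_rpow_neg_atTop (by linarith)).comp (Filter.tendsto_atTop_add_const_right _ _ tendsto_natCast_atTop_atTop)
      refine this.congr ?_
      intro n
      have := Complex.norm_cpow_eq_rpow_re_of_pos (show (0:ℝ) < (n:ℝ)+1 by positivity) (1-s)
      push_cast at this
      rw [this]; simp
    have hsumm : Summable (fun n : ℕ => ((n:ℂ)+1) ^ (1-s) - ((n:ℂ)+1+1) ^ (1-s)) := by
      have h3 : Summable (fun n => vterm n s) :=
        Summable.of_norm_bounded ((summable_aux (show 0 < s.re by linarith)).mul_left (‖s - 1‖ * ‖s‖))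
          (fun n => vterm_bound n s (by linarith))
      refine (hs2.summable.sub h3).congr ?_
      intro n; simp only [vterm]; ring
    have := hsumm.hasSum.tendsto_sum_nat
    have h5 : Filter.Tendsto (fun n : ℕ => ∑ i ∈ Finset.range n, (((i:ℂ)+1) ^ (1-s) - ((i:ℂ)+1+1) ^ (1-s))) Filter.atTop (nhds (1 - 0)) := by
      have e : ∀ n : ℕ, ∑ i ∈ Finset.range n, (((i:ℂ)+1) ^ (1-s) - ((i:ℂ)+1+1) ^ (1-s)) = 1 - ((n:ℂ)+1)^(1-s) := by
        intro n
        have := Finset.sum_range_sub' (fun i : ℕ => ((i:ℂ)+1) ^ (1-s)) n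
        simpa using this
      simp_rw [e]
      exact tendsto_const_nhds.sub hlim
    rw [sub_zero] at h5
    have h6 := hsumm.hasSum
    rwa [tendsto_nhds_unique this h5] at h6
  have := (hs2.sub ht).tsum_eq
  rw [h2]
  have e : (fun n => vterm n s) = (fun n : ℕ => (s-1) * ((n:ℂ)+1)^(-s) - (((n:ℂ)+1) ^ (1-s) - ((n:ℂ)+1+1) ^ (1-s))) := by
    funext n; simp only [vterm]; ring
  rw [e, this]; ring

lemma zeta1_eq (s : ℂ) (hs : 0 < s.re) : riemannZeta₁ s = 1 + ∑' n, vterm n s := by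
  have hopen : IsOpen {s : ℂ | 0 < s.re} := isOpen_lt continuous_const Complex.continuous_re
  have hf : AnalyticOnNhd ℂ riemannZeta₁ {s : ℂ | 0 < s.re} :=
    differentiable_riemannZeta₁.differentiableOn.analyticOnNhd hopen
  have hg : AnalyticOnNhd ℂ (fun s => 1 + ∑' n, vterm n s) {s : ℂ | 0 < s.re} :=
    (vsum_diff.const_add 1).analyticOnNhd hopen
  have hpre : IsPreconnected {s : ℂ | 0 < s.re} := (convex_halfSpace_re_gt 0).isPreconnected
  refine hf.eqOn_of_preconnected_of_eventuallyEq hg hpre (z₀ := 2) (by simp) ?_ hs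
  have : {s : ℂ | 1 < s.re} ∈ nhds (2:ℂ) :=
    (isOpen_lt continuous_const Complex.continuous_re).mem_nhds (by simp)
  filter_upwards [this] with s hs
  exact zeta1_of_one_lt s hs

lemma trap {σ : ℝ} (h0 : 0 < σ) (h1 : σ < 1) {n : ℝ} (hn : 0 < n) :
    ((n+1)^(1-σ) - n^(1-σ)) / (1-σ) ≤ (n^(-σ) + (n+1)^(-σ))/2 := by
  have hmono : MonotoneOn (fun y : ℝ => (y-n)*(n^(-σ)+y^(-σ))/2 - (y^(1-σ) - n^(1-σ))/(1-σ)) (Set.Icc n (n+1)) := by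
    have hder : ∀ y : ℝ, 0 < y → HasDerivAt (fun y : ℝ => (y-n)*(n^(-σ)+y^(-σ))/2 - (y^(1-σ) - n^(1-σ))/(1-σ))
        ((1*(n^(-σ)+y^(-σ)) + (y-n)*((-σ)*y^(-σ-1)))/2 - ((1-σ)*y^(1-σ-1))/(1-σ)) y := by
      intro y hy
      have a := ((hasDerivAt_id y).sub_const n).mul ((Real.hasDerivAt_rpow_const (p := -σ) (Or.inl hy.ne')).const_add (n^(-σ)))
      have b := ((Real.hasDerivAt_rpow_const (p := 1-σ) (Or.inl hy.ne')).sub_const (n^(1-σ))).div_const (1-σ)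
      exact (a.div_const 2).sub b
    apply monotoneOn_of_deriv_nonneg (convex_Icc _ _)
    · intro y hy
      exact (hder y (hn.trans_le hy.1)).continuousAt.continuousWithinAt
    · intro y hy
      rw [interior_Icc] at hy
      exact (hder y (hn.trans hy.1)).differentiableAt.differentiableWithinAt
    · intro y hy
      rw [interior_Icc] at hy
      have hy0 : 0 < y := hn.trans hy.1
      rw [(hder y hy0).deriv]
      have e1 : (1-σ)*y^(1-σ-1)/(1-σ) = y^(-σ) := by
        rw [show 1-σ-1 = -σ by ring]; field_simp [show (1-σ) ≠ 0 by linarith]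
      rw [e1]
      have e2 : y^(-σ-1) = y^(-σ)/y := by rw [Real.rpow_sub_one hy0.ne']
      have e3 : n^(-σ) = y^(-σ) * (n/y)^(-σ) := by
        rw [← Real.mul_rpow hy0.le (by positivity)]; congr 1; field_simp
      have e4 : 1 - σ * (n/y - 1) ≤ (n/y)^(-σ) := by
        rw [Real.rpow_def_of_pos (by positivity)]
        have := Real.add_one_le_exp (Real.log (n/y) * (-σ))
        have := Real.log_le_sub_one_of_pos (show 0 < n/y by positivity)
        nlinarith
      have hp : 0 < y^(-σ) := by positivity
      rw [e2, e3]
      have e5 : (y-n)*((-σ)*(y^(-σ)/y)) = y^(-σ) * (-σ * (1 - n/y)) := by field_simp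
      rw [e5]
      nlinarith [mul_le_mul_of_nonneg_left e4 hp.le]
  have := hmono (Set.left_mem_Icc.mpr (by linarith)) (Set.right_mem_Icc.mpr (by linarith)) (by linarith : n ≤ n+1)
  simp at this
  linarith

theorem zeta_lower (z : ℝ) (h0 : 0 < z) (h1 : z < 1) :
    -(1/z - 1/2) ≤ (riemannZeta ((1 - z : ℝ) : ℂ)).re := by
  set σ : ℝ := 1 - z with hσ
  have hσ0 : 0 < σ := by linarith
  have hσ1 : σ < 1 := by linarith
  have hne : ((σ:ℝ):ℂ) ≠ 1 := by exact_mod_cast hσ1.ne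
  have hz1 := zeta1_eq (σ:ℂ) (by simpa using hσ0)
  have hsum : Summable (fun n => vterm n (σ:ℂ)) :=
    Summable.of_norm_bounded ((summable_aux (show 0 < ((σ:ℂ)).re by simpa using hσ0)).mul_left (‖(σ:ℂ) - 1‖ * ‖(σ:ℂ)‖))
          (fun n => vterm_bound n σ (by simpa using hσ0))
  have hv : ∀ n : ℕ, vterm n (σ:ℂ) = (((σ-1) * ((n:ℝ)+1)^(-σ) - ((n:ℝ)+1)^(1-σ) + ((n:ℝ)+1+1)^(1-σ) : ℝ) : ℂ) := by
    intro n
    have hn : (0:ℝ) ≤ (n:ℝ)+1 := by positivity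
    have hn' : (0:ℝ) ≤ (n:ℝ)+1+1 := by positivity
    simp only [vterm]
    push_cast [Complex.ofReal_cpow hn, Complex.ofReal_cpow hn']
    rfl
  set w : ℕ → ℝ := fun n => (σ-1) * ((n:ℝ)+1)^(-σ) - ((n:ℝ)+1)^(1-σ) + ((n:ℝ)+1+1)^(1-σ) with hw
  have hsw : Summable w := by
    have : Summable (fun n => ((w n : ℝ):ℂ)) := by simpa only [hv] using hsum
    exact Complex.summable_ofReal.mp this
  have hle : ∀ n, w n ≤ (σ-1)/2 * (((n:ℝ)+1)^(-σ) - ((n:ℝ)+1+1)^(-σ)) := by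
    intro n
    have := trap hσ0 hσ1 (show (0:ℝ) < (n:ℝ)+1 by positivity)
    rw [div_le_iff₀ (by linarith)] at this
    simp only [hw]
    nlinarith
  have hsum2 : ∑' n, w n ≤ (σ-1)/2 := by
    have hlim : Filter.Tendsto (fun n : ℕ => (σ-1)/2 * (1 - ((n:ℝ)+1)^(-σ))) Filter.atTop (nhds ((σ-1)/2 * (1-0))) := by
      refine Filter.Tendsto.const_mul _ (tendsto_const_nhds.sub ?_)
      exact (tendsto_rpow_neg_atTop hσ0).comp (Filter.tendsto_atTop_add_const_right _ _ tendsto_natCast_atTop_atTop)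
    have h2 := hsw.hasSum.tendsto_sum_nat
    have := le_of_tendsto_of_tendsto' h2 hlim (fun n => by
      refine (Finset.sum_le_sum (fun i _ => hle i)).trans ?_
      rw [← Finset.mul_sum]
      have := Finset.sum_range_sub' (fun i : ℕ => ((i:ℝ)+1) ^ (-σ)) n
      simp only [Nat.cast_add, Nat.cast_one] at this
      rw [this]; simp)
    simpa using this
  have hz : riemannZeta₁ (σ:ℂ) = ((1 + ∑' n, w n : ℝ):ℂ) := by
    rw [hz1]; push_cast; congr 1; exact tsum_congr hv
  rw [riemannZeta_eq_inv_sub_mul hne, hz]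
  have : ((σ:ℂ) - 1)⁻¹ * ((1 + ∑' n, w n : ℝ):ℂ) = (((σ-1)⁻¹ * (1 + ∑' n, w n) : ℝ) : ℂ) := by push_cast; rfl
  rw [this, Complex.ofReal_re]
  have hz' : σ - 1 = -z := by rw [hσ]; ring
  rw [hz'] at hsum2 ⊢
  rw [inv_neg, neg_mul]
  have : z⁻¹ * (1 + ∑' n, w n) ≤ z⁻¹ * (1 - z/2) := by gcongr; linarith
  have e : z⁻¹ * (1 - z/2) = 1/z - 1/2 := by field_simp
  linarith

end RB

namespace RB

noncomputable def th (w : ℝ) : ℝ := ∑' n : ℤ, rexp (-π * w * (n:ℝ)^2)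

lemma th_summable {w : ℝ} (hw : 0 < w) : Summable (fun n : ℤ => rexp (-π * w * (n:ℝ)^2)) := by
  have h : Summable (fun n : ℕ => rexp (-π * w * (n:ℝ)^2)) := by
    have hq : rexp (-π * w) < 1 := by
      rw [Real.exp_lt_one_iff]; nlinarith [Real.pi_pos]
    refine Summable.of_nonneg_of_le (fun n => (Real.exp_pos _).le) (fun n => ?_)
      (summable_geometric_of_lt_one (Real.exp_pos _).le hq)
    rw [← Real.exp_nat_mul]
    apply Real.exp_le_exp.mpr
    have : (n:ℝ) ≤ (n:ℝ)^2 := by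
      rcases Nat.eq_zero_or_pos n with h | h
      · simp [h]
      · have : (1:ℝ) ≤ n := by exact_mod_cast h
        nlinarith
    nlinarith [mul_pos Real.pi_pos hw]
  apply Summable.of_nat_of_neg
  · simpa using h
  · simpa using h

lemma th_one_le {w : ℝ} (hw : 0 < w) : 1 ≤ th w := by
  have := (th_summable hw).le_tsum (0:ℤ) (fun _ _ => (Real.exp_pos _).le)
  simpa [th] using this

lemma th_dual {w : ℝ} (hw : 0 < w) : th w ^ 2 = th (1/w) ^ 2 / w := by
  have := Real.tsum_exp_neg_mul_int_sq hw
  unfold th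
  rw [this, mul_pow]
  have e : ((1:ℝ) / w ^ (1/2:ℝ))^2 = 1 / w := by
    rw [div_pow, one_pow, ← Real.rpow_natCast, ← Real.rpow_mul hw.le]; norm_num
  rw [e]
  have : ∀ n : ℤ, -π / w * (n:ℝ)^2 = -π * (1/w) * (n:ℝ)^2 := by intro n; ring
  simp_rw [this]
  ring

lemma th_le {w : ℝ} (hw : 0 < w) : th w ≤ 1 + 2 * (rexp (-π*w) / (1 - rexp (-π*w))) := by
  have hq : rexp (-π * w) < 1 := by
    rw [Real.exp_lt_one_iff]; nlinarith [Real.pi_pos]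
  have hg := hasSum_geometric_of_lt_one (Real.exp_pos (-π*w)).le hq
  have h1 : Summable (fun n : ℕ => rexp (-π * w * ((n:ℝ)+1)^2)) := by
    refine Summable.of_nonneg_of_le (fun n => (Real.exp_pos _).le) (fun n => ?_) hg.summable
    rw [← Real.exp_nat_mul]
    apply Real.exp_le_exp.mpr
    nlinarith [mul_pos Real.pi_pos hw, mul_nonneg (mul_pos Real.pi_pos hw).le (Nat.cast_nonneg (α := ℝ) n), mul_nonneg (mul_pos Real.pi_pos hw).le (sq_nonneg (n:ℝ))]
  have h2 : ∑' n : ℕ, rexp (-π * w * ((n:ℝ)+1)^2) ≤ rexp (-π*w) / (1 - rexp (-π*w)) := by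
    have : rexp (-π*w) / (1 - rexp (-π*w)) = ∑' n : ℕ, rexp (-π*w) * rexp (-π*w) ^ n := by
      rw [tsum_mul_left, hg.tsum_eq]; rfl
    rw [this]
    refine h1.tsum_le_tsum (fun n => ?_) (hg.summable.mul_left _)
    rw [← Real.exp_nat_mul, ← Real.exp_add]
    apply Real.exp_le_exp.mpr
    nlinarith [mul_pos Real.pi_pos hw, mul_nonneg (mul_pos Real.pi_pos hw).le (Nat.cast_nonneg (α := ℝ) n), mul_nonneg (mul_pos Real.pi_pos hw).le (sq_nonneg (n:ℝ))]
  have h3 : th w = rexp (-π * w * ((0:ℤ):ℝ)^2) + 2 * ∑' n : ℕ, rexp (-π * w * ((n:ℝ)+1)^2) := by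
    have hh := HasSum.of_add_one_of_neg_add_one (f := fun n : ℤ => rexp (-π * w * (n:ℝ)^2))
      (m := ∑' n : ℕ, rexp (-π * w * ((n:ℝ)+1)^2)) (m' := ∑' n : ℕ, rexp (-π * w * ((n:ℝ)+1)^2)) ?_ ?_
    · unfold th; rw [hh.tsum_eq]; ring
    · simpa using h1.hasSum
    · have e : (fun n : ℕ => rexp (-π * w * (((-((n:ℤ)+1) : ℤ)):ℝ)^2)) = (fun n : ℕ => rexp (-π * w * ((n:ℝ)+1)^2)) := by
        funext n; push_cast; ring_nf
      rw [e]; exact h1.hasSum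
  have h0 : rexp (-π * w * ((0:ℤ):ℝ)^2) = 1 := by simp
  rw [h3, h0]; linarith

lemma th_sq_lt {w : ℝ} (hw : 1 ≤ w) : th w ^ 2 - 1 < (1+2*w)/(w*(1+w)^3) := by
  have hw0 : 0 < w := by linarith
  have h := th_le hw0
  have h1 := th_one_le hw0
  set q := rexp (-π*w) with hq
  have hq0 : 0 < q := Real.exp_pos _
  have hP : 1 + 3*w + 9/2*w^2 + 9/2*w^3 + 27/8*w^4 ≤ rexp (3*w) := by
    have := Real.sum_le_exp_of_nonneg (show 0 ≤ 3*w by linarith) 5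
    simp [Finset.sum_range_succ, Nat.factorial] at this
    nlinarith
  have hqP : q * (1 + 3*w + 9/2*w^2 + 9/2*w^3 + 27/8*w^4) ≤ 1 := by
    have : q * rexp (3*w) ≤ 1 := by
      rw [hq, ← Real.exp_add, Real.exp_le_one_iff]
      nlinarith [Real.pi_gt_three]
    nlinarith [mul_le_mul_of_nonneg_left hP hq0.le]
  set P := 1 + 3*w + 9/2*w^2 + 9/2*w^3 + 27/8*w^4 with hPd
  have hP16 : 16 ≤ P := by
    have : 1 ≤ w^2 := by nlinarith
    have : 1 ≤ w^3 := one_le_pow₀ hw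
    have : 1 ≤ w^4 := one_le_pow₀ hw
    rw [hPd]; linarith
  have hq16 : q ≤ 1/16 := by
    have : q * 16 ≤ q * P := by gcongr
    linarith
  have hx : q / (1-q) ≤ 16/15 * q := by
    rw [div_le_iff₀ (by linarith)]; nlinarith
  have hx2 : th w ≤ 1 + 32/15*q := by linarith
  have hth : th w ^2 - 1 ≤ 5 * q := by
    have : th w ^ 2 ≤ (1 + 32/15*q)^2 := by gcongr
    nlinarith
  have hqP' : q ≤ 1/P := by rw [le_div_iff₀ (by linarith)]; exact hqP
  refine lt_of_le_of_lt (hth.trans (mul_le_mul_of_nonneg_left hqP' (by norm_num))) ?_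
  rw [mul_one_div, div_lt_div_iff₀ (by linarith) (by positivity), hPd]
  obtain ⟨v, hv⟩ : ∃ v, w = 1 + v := ⟨w-1, by ring⟩
  have hv0 : 0 ≤ v := by linarith
  subst hv
  ring_nf
  have := pow_nonneg hv0 2
  have := pow_nonneg hv0 3
  have := pow_nonneg hv0 4
  have := pow_nonneg hv0 5
  linarith

/-- main pointwise inequality -/
lemma th_main {w : ℝ} (hw : 0 < w) :
    1/(1+w) + w/(1+w)^3 < 1 + 1/w - th w ^ 2 := by
  rcases le_total 1 w with h | h
  · have := th_sq_lt h
    have e : 1 + 1/w - (1/(1+w) + w/(1+w)^3) = 1 + (1+2*w)/(w*(1+w)^3) := by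
      field_simp; ring
    linarith
  · have h' : 1 ≤ 1/w := by rw [le_div_iff₀ hw]; linarith
    have := th_sq_lt h'
    have e0 : (1+2*(1/w))/(1/w*(1+1/w)^3) = w^3*(w+2)/(1+w)^3 := by
      field_simp
      ring
    rw [e0] at this
    rw [th_dual hw]
    have e1 : 1 + 1/w - (1/(1+w) + w/(1+w)^3) = (1 + w^3*(w+2)/(1+w)^3) / w := by
      field_simp; ring
    have : th (1/w) ^2 / w < (1 + w^3*(w+2)/(1+w)^3) / w := by
      gcongr; linarith
    linarith

lemma th_small {w : ℝ} (hw : 0 < w) (hw1 : w ≤ 1) : th w ^ 2 * w ≤ 11/8 := by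
  have h' : 1 ≤ 1/w := by rw [le_div_iff₀ hw]; linarith
  have := th_sq_lt h'
  have e0 : (1+2*(1/w))/(1/w*(1+1/w)^3) ≤ 3/8 := by
    rw [div_le_div_iff₀ (by positivity) (by norm_num)]
    obtain ⟨v, hv⟩ : ∃ v, 1/w = 1 + v := ⟨1/w-1, by ring⟩
    rw [hv]
    have hv0 : 0 ≤ v := by linarith
    have := pow_nonneg hv0 2
    have := pow_nonneg hv0 3
    have := pow_nonneg hv0 4
    ring_nf
    linarith
  rw [th_dual hw, div_mul_cancel₀ _ hw.ne']
  linarith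

lemma th_large {w : ℝ} (hw : 1 ≤ w) : th w ^ 2 - 1 ≤ 1/w^2 := by
  refine (th_sq_lt hw).le.trans ?_
  rw [div_le_div_iff₀ (by positivity) (by positivity)]
  have := pow_nonneg (show 0 ≤ w by linarith) 2
  have := pow_nonneg (show 0 ≤ w by linarith) 3
  have := pow_nonneg (show 0 ≤ w by linarith) 4
  nlinarith
end RB

namespace RB
open MeasureTheory

noncomputable def aR (m : ℕ) (w : ℝ) : ℝ :=
  ∫ x in (0:ℝ)..m, ∫ y in (0:ℝ)..m, rexp (-π * w * (x-y)^2)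

noncomputable def bR (m : ℕ) (w : ℝ) : ℝ :=
  ∑ i ∈ Finset.range m, ∑ j ∈ Finset.range m, rexp (-π * w * ((i:ℝ)-(j:ℝ))^2)

lemma cont_inner (w a b : ℝ) : Continuous (fun x : ℝ => ∫ y in a..b, rexp (-π * w * (x-y)^2)) := by
  apply intervalIntegral.continuous_parametric_intervalIntegral_of_continuous'
  fun_prop

lemma cell_lower (w : ℝ) (hw : 0 < w) (i j : ℝ) :
    rexp (-π*w) * rexp (-π * w * (i-j)^2) ≤
      ∫ x in i..(i+1), ∫ y in j..(j+1), rexp (-π * w * (x-y)^2) := by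
  set C := rexp (-π*w) * rexp (-π * w * (i-j)^2) with hC
  have hC0 : 0 < C := by positivity
  have key : ∀ x ∈ Set.Icc i (i+1), ∀ y ∈ Set.Icc j (j+1),
      C * (1 - 2*π*w*(i-j)*((x-i)-(y-j))) ≤ rexp (-π * w * (x-y)^2) := by
    intro x hx y hy
    have h1 : rexp (-π * w * (x-y)^2) = rexp (-π * w * (i-j)^2) * rexp (-π*w*((x-i)-(y-j))^2)
       * rexp (- (2*π*w*(i-j)*((x-i)-(y-j)))) := by
      rw [← Real.exp_add, ← Real.exp_add]; congr 1; ring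
    have h2 : rexp (-π*w) ≤ rexp (-π*w*((x-i)-(y-j))^2) := by
      apply Real.exp_le_exp.mpr
      have : ((x-i)-(y-j))^2 ≤ 1 := by
        have := hx.1; have := hx.2; have := hy.1; have := hy.2
        rw [sq_le_one_iff_abs_le_one, abs_le]; constructor <;> linarith
      nlinarith [mul_pos Real.pi_pos hw]
    have h3 : 1 - 2*π*w*(i-j)*((x-i)-(y-j)) ≤ rexp (- (2*π*w*(i-j)*((x-i)-(y-j)))) := by
      have := Real.add_one_le_exp (- (2*π*w*(i-j)*((x-i)-(y-j)))); linarith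
    rw [h1]
    calc _ ≤ C * rexp (- (2*π*w*(i-j)*((x-i)-(y-j)))) := by gcongr
      _ ≤ _ := by
        rw [hC, mul_comm (rexp (-π*w))]
        gcongr
  have hinner : ∀ x : ℝ, ∫ y in j..(j+1), C * (1 - 2*π*w*(i-j)*((x-i)-(y-j))) = C * (1 - 2*π*w*(i-j)*((x-i)-1/2)) := by
    intro x
    have : ∀ y : ℝ, C * (1 - 2*π*w*(i-j)*((x-i)-(y-j))) = C * (1 - 2*π*w*(i-j)*((x-i)+j)) + C*(2*π*w*(i-j)) * y := by
      intro y; ring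
    simp_rw [this]
    rw [intervalIntegral.integral_add (by simp) (by apply Continuous.intervalIntegrable; fun_prop),
      intervalIntegral.integral_const, intervalIntegral.integral_const_mul, integral_id]
    simp only [smul_eq_mul]
    ring
  have houter : ∫ x in i..(i+1), C * (1 - 2*π*w*(i-j)*((x-i)-1/2)) = C := by
    have : ∀ x : ℝ, C * (1 - 2*π*w*(i-j)*((x-i)-1/2)) = C * (1 + 2*π*w*(i-j)*(i+1/2)) + (-C*(2*π*w*(i-j))) * x := by
      intro y; ring
    simp_rw [this]
    rw [intervalIntegral.integral_add (by simp) (by apply Continuous.intervalIntegrable; fun_prop),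
      intervalIntegral.integral_const, intervalIntegral.integral_const_mul, integral_id]
    simp only [smul_eq_mul]
    ring
  rw [← houter]
  apply intervalIntegral.integral_mono_on (by linarith)
  · apply Continuous.intervalIntegrable; fun_prop
  · exact (cont_inner w j (j+1)).intervalIntegrable _ _
  · intro x hx
    rw [← hinner x]
    apply intervalIntegral.integral_mono_on (by linarith)
    · apply Continuous.intervalIntegrable; fun_prop
    · apply Continuous.intervalIntegrable; fun_prop
    · intro y hy
      exact key x hx y hy

lemma a_ge_b (m : ℕ) (w : ℝ) (hw : 0 < w) : rexp (-π*w) * bR m w ≤ aR m w := by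
  have h1 : aR m w = ∑ i ∈ Finset.range m, ∑ j ∈ Finset.range m,
      ∫ x in (i:ℝ)..((i:ℝ)+1), ∫ y in (j:ℝ)..((j:ℝ)+1), rexp (-π * w * (x-y)^2) := by
    unfold aR
    have e1 : ∀ x : ℝ, ∫ y in (0:ℝ)..m, rexp (-π * w * (x-y)^2) =
        ∑ j ∈ Finset.range m, ∫ y in (j:ℝ)..((j:ℝ)+1), rexp (-π * w * (x-y)^2) := by
      intro x
      have := intervalIntegral.sum_integral_adjacent_intervals (μ := volume) (f := fun y => rexp (-π * w * (x-y)^2))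
        (a := fun k : ℕ => (k:ℝ)) (n := m) (fun k _ => by apply Continuous.intervalIntegrable; fun_prop)
      simpa using this.symm
    have e2 := intervalIntegral.sum_integral_adjacent_intervals (μ := volume)
        (f := fun x => ∫ y in (0:ℝ)..m, rexp (-π * w * (x-y)^2))
        (a := fun k : ℕ => (k:ℝ)) (n := m) (fun k _ => (cont_inner w 0 m).intervalIntegrable _ _)
    simp only [Nat.cast_zero, Nat.cast_add, Nat.cast_one] at e2
    rw [← e2]
    refine Finset.sum_congr rfl (fun i _ => ?_)
    simp_rw [e1]
    rw [intervalIntegral.integral_finsetSum]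
    intro j _
    exact (cont_inner w _ _).intervalIntegrable _ _
  rw [h1, bR, Finset.mul_sum]
  refine Finset.sum_le_sum (fun i _ => ?_)
  rw [Finset.mul_sum]
  exact Finset.sum_le_sum (fun j _ => cell_lower w hw i j)

lemma aR_nonneg (m : ℕ) (w : ℝ) : 0 ≤ aR m w := by
  unfold aR
  apply intervalIntegral.integral_nonneg (by positivity)
  intro x _
  apply intervalIntegral.integral_nonneg (by positivity)
  intro y _
  positivity

lemma bR_nonneg (m : ℕ) (w : ℝ) : 0 ≤ bR m w := by
  unfold bR; positivity

lemma b_le_th (m : ℕ) (w : ℝ) (hw : 0 < w) : bR m w ≤ m * th w := by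
  unfold bR
  have : ∀ i ∈ Finset.range m, ∑ j ∈ Finset.range m, rexp (-π * w * ((i:ℝ)-(j:ℝ))^2) ≤ th w := by
    intro i _
    have hinj : Function.Injective (fun j : ℕ => (i:ℤ) - (j:ℤ)) := by
      intro a b h; simp at h; exact h
    have := (th_summable hw).sum_le_tsum ((Finset.range m).map ⟨_, hinj⟩) (fun _ _ => (Real.exp_pos _).le)
    simpa [th] using this
  refine (Finset.sum_le_sum this).trans ?_
  simp

lemma b_ge_m (m : ℕ) (w : ℝ) : (m:ℝ) ≤ bR m w := by
  unfold bR
  have : ∀ i ∈ Finset.range m, (1:ℝ) ≤ ∑ j ∈ Finset.range m, rexp (-π * w * ((i:ℝ)-(j:ℝ))^2) := by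
    intro i hi
    have := Finset.single_le_sum (f := fun j : ℕ => rexp (-π * w * ((i:ℝ)-(j:ℝ))^2)) (fun _ _ => (Real.exp_pos _).le) hi
    simpa using this
  refine le_trans ?_ (Finset.sum_le_sum this)
  simp

noncomputable def lo (m : ℕ) (w : ℝ) : ℝ :=
  (1 - 2 * (√(m:ℝ))⁻¹) * ∫ v in (-√(m:ℝ))..(√(m:ℝ)), rexp (-(π * w) * v^2)

lemma lo_le (m : ℕ) (hm : 0 < m) (w : ℝ) : lo m w ≤ aR m w / m := by
  have hm' : (0:ℝ) < m := by exact_mod_cast hm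
  set L := √(m:ℝ) with hL
  have hL0 : 0 < L := Real.sqrt_pos.mpr hm'
  have hLL : L * L = m := Real.mul_self_sqrt hm'.le
  set G := ∫ v in (-L)..L, rexp (-(π * w) * v^2) with hG
  have hG0 : 0 ≤ G := by
    apply intervalIntegral.integral_nonneg (by linarith)
    intro y _; positivity
  rw [le_div_iff₀ hm']
  have e : lo m w * m = (m - 2*L) * G := by
    unfold lo; rw [← hL, ← hG, ← hLL]; field_simp
  rw [e]
  by_cases hneg : (m:ℝ) - 2*L ≤ 0
  · exact (mul_nonpos_of_nonpos_of_nonneg hneg hG0).trans (aR_nonneg m w)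
  push Not at hneg
  have h1 : (m - 2*L) * G = ∫ x in L..(m-L), G := by simp; left; ring
  rw [h1]
  unfold aR
  calc ∫ x in L..(m-L), G ≤ ∫ x in L..(m-L), ∫ y in (0:ℝ)..m, rexp (-π * w * (x-y)^2) := by
        apply intervalIntegral.integral_mono_on (by linarith)
        · simp
        · exact (cont_inner w _ _).intervalIntegrable _ _
        · intro x hx
          have := intervalIntegral.integral_comp_sub_left (f := fun v => rexp (-(π * w) * v^2)) (a := 0) (b := m) x
          have e2 : ∀ y : ℝ, rexp (-π * w * (x-y)^2) = rexp (-(π * w) * (x-y)^2) := by intro y; ring_nf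
          simp_rw [e2]
          rw [this, hG]
          apply intervalIntegral.integral_mono_interval
          · linarith [hx.2]
          · linarith
          · linarith [hx.1]
          · exact Filter.Eventually.of_forall (fun v => (Real.exp_pos _).le)
          · apply Continuous.intervalIntegrable; fun_prop
    _ ≤ _ := by
        apply intervalIntegral.integral_mono_interval
        · linarith
        · linarith
        · linarith
        · refine Filter.Eventually.of_forall (fun x => ?_)
          apply intervalIntegral.integral_nonneg (by positivity)
          intro y _; positivity
        · exact (cont_inner w _ _).intervalIntegrable _ _

lemma lo_nonneg_tendsto (w : ℝ) (hw : 0 < w) :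
    Filter.Tendsto (fun m : ℕ => (max (lo m w) 0)^2) Filter.atTop (nhds (1/w)) := by
  have hs : Filter.Tendsto (fun m : ℕ => √(m:ℝ)) Filter.atTop Filter.atTop :=
    Real.tendsto_sqrt_atTop.comp tendsto_natCast_atTop_atTop
  have h1 : Filter.Tendsto (fun m : ℕ => ∫ v in (-√(m:ℝ))..(√(m:ℝ)), rexp (-(π * w) * v^2)) Filter.atTop
      (nhds (∫ v, rexp (-(π * w) * v^2))) :=
    intervalIntegral_tendsto_integral (integrable_exp_neg_mul_sq (by positivity))
      (Filter.tendsto_neg_atTop_atBot.comp hs) hs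
  have h2 : Filter.Tendsto (fun m : ℕ => (1 - 2 * (√(m:ℝ))⁻¹)) Filter.atTop (nhds (1 - 2*0)) :=
    tendsto_const_nhds.sub ((tendsto_inv_atTop_zero.comp hs).const_mul 2)
  have h3 := h2.mul h1
  rw [integral_gaussian] at h3
  have h4 := (h3.max (tendsto_const_nhds (x := (0:ℝ)))).pow 2
  have e : (max ((1 - 2*0) * √(π / (π * w))) 0)^2 = 1/w := by
    rw [mul_zero, sub_zero, one_mul, max_eq_left (Real.sqrt_nonneg _), Real.sq_sqrt (by positivity)]
    field_simp
  rw [e] at h4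
  exact h4

noncomputable def kap (w : ℝ) : ℝ := if w ≤ 1 then 9 else 1/w^2

noncomputable def hm (m : ℕ) (w : ℝ) : ℝ := 1 + (aR m w / m)^2 - (bR m w / m)^2

lemma hm_kap (m : ℕ) (h : 0 < m) (w : ℝ) (hw : 0 < w) : 0 ≤ hm m w + kap w := by
  have hm' : (0:ℝ) < m := by exact_mod_cast h
  have hb : bR m w / m ≤ th w := by rw [div_le_iff₀ hm', mul_comm]; exact b_le_th m w hw
  have hb0 : 0 ≤ bR m w / m := div_nonneg (bR_nonneg _ _) hm'.le
  have ha0 : 0 ≤ aR m w / m := div_nonneg (aR_nonneg _ _) hm'.le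
  have hb2 : (bR m w / m)^2 ≤ th w ^ 2 := by gcongr
  unfold kap hm
  split_ifs with h1
  · have ha : rexp (-π*w) * (bR m w / m) ≤ aR m w / m := by
      rw [← mul_div_assoc]; gcongr; exact a_ge_b m w hw
    have hs := th_small hw h1
    have he : 1 - π*w ≤ rexp (-π*w) := by
      have := Real.add_one_le_exp (-π*w); linarith
    have he2 : 1 - 2*π*w ≤ rexp (-π*w)^2 := by
      rw [← Real.exp_nat_mul]
      have := Real.add_one_le_exp ((2:ℕ) * (-π*w)); push_cast at this ⊢; linarith
    have ha2 : rexp (-π*w)^2 * (bR m w / m)^2 ≤ (aR m w / m)^2 := by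
      rw [← mul_pow]; gcongr
    have h5 : (1 - 2*π*w) * (bR m w / m)^2 ≤ (aR m w / m)^2 :=
      (mul_le_mul_of_nonneg_right he2 (sq_nonneg _)).trans ha2
    have h6 : (2*π*w) * (bR m w / m)^2 ≤ 2*π*(11/8) := by
      calc (2*π*w) * (bR m w / m)^2 ≤ (2*π*w) * th w^2 := by gcongr
        _ = 2*π*(th w ^2 * w) := by ring
        _ ≤ _ := by gcongr
    nlinarith [Real.pi_lt_d2]
  · push Not at h1
    have := th_large h1.le
    nlinarith [sq_nonneg (aR m w / m)]

lemma hm_lower (m : ℕ) (h : 0 < m) (w : ℝ) (hw : 0 < w) :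
    1 + (max (lo m w) 0)^2 - th w ^ 2 ≤ hm m w := by
  have hm' : (0:ℝ) < m := by exact_mod_cast h
  have hb : bR m w / m ≤ th w := by rw [div_le_iff₀ hm', mul_comm]; exact b_le_th m w hw
  have hb0 : 0 ≤ bR m w / m := div_nonneg (bR_nonneg _ _) hm'.le
  have ha0 : 0 ≤ aR m w / m := div_nonneg (aR_nonneg _ _) hm'.le
  have hb2 : (bR m w / m)^2 ≤ th w ^ 2 := by gcongr
  have : (max (lo m w) 0)^2 ≤ (aR m w / m)^2 := by
    have := max_le (lo_le m h w) ha0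
    gcongr
  unfold hm; linarith

lemma cont_aR (m : ℕ) : Continuous (aR m) := by
  unfold aR
  apply intervalIntegral.continuous_parametric_intervalIntegral_of_continuous'
  have : Continuous (fun p : (ℝ × ℝ) => ∫ y in (0:ℝ)..m, rexp (-π * p.1 * (p.2-y)^2)) := by
    apply intervalIntegral.continuous_parametric_intervalIntegral_of_continuous'
    fun_prop
  exact this

lemma cont_bR (m : ℕ) : Continuous (bR m) := by
  unfold bR; fun_prop

end RB

namespace RB
open MeasureTheory
open Set

lemma gamL (a r : ℝ) (ha : 0 < a) (hr : 0 < r) :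
    ∫⁻ t in Ioi (0:ℝ), ENNReal.ofReal (t^(a-1) * rexp (-(r*t))) = ENNReal.ofReal ((1/r)^a * Real.Gamma a) := by
  have h := Real.integral_rpow_mul_exp_neg_mul_Ioi ha hr
  have hpos : 0 < (1/r)^a * Real.Gamma a := mul_pos (by positivity) (Real.Gamma_pos_of_pos ha)
  have hi : Integrable (fun t : ℝ => t^(a-1) * rexp (-(r*t))) (volume.restrict (Ioi 0)) := by
    by_contra hn
    rw [integral_undef hn] at h
    exact hpos.ne h
  rw [← h, ofReal_integral_eq_lintegral_ofReal hi]
  filter_upwards [self_mem_ae_restrict measurableSet_Ioi] with t ht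
  have : (0:ℝ) < t := ht
  simp only [Pi.zero_apply]
  positivity

lemma betaL (z a : ℝ) (hz : 0 < z) (ha : z < a) :
    ∫⁻ w in Ioi (0:ℝ), ENNReal.ofReal (w^(z-1) * (1/(1+w))^a) =
      ENNReal.ofReal (Real.Gamma z * Real.Gamma (a - z) / Real.Gamma a) := by
  have ha0 : 0 < a := hz.trans ha
  have hGa := Real.Gamma_pos_of_pos ha0
  have hGz := Real.Gamma_pos_of_pos hz
  have h1 : ∀ w ∈ Ioi (0:ℝ), ENNReal.ofReal (w^(z-1) * (1/(1+w))^a) =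
      ENNReal.ofReal (1/Real.Gamma a) * ∫⁻ t in Ioi (0:ℝ), ENNReal.ofReal (w^(z-1) * (t^(a-1) * rexp (-((1+w)*t)))) := by
    intro w hw
    have hw : 0 < w := hw
    have e : ∀ t : ℝ, ENNReal.ofReal (w^(z-1) * (t^(a-1) * rexp (-((1+w)*t)))) =
       ENNReal.ofReal (w^(z-1)) * ENNReal.ofReal (t^(a-1) * rexp (-((1+w)*t))) := by
      intro t; rw [ENNReal.ofReal_mul (by positivity)]
    simp_rw [e]
    rw [lintegral_const_mul' _ _ ENNReal.ofReal_ne_top, gamL a (1+w) ha0 (by positivity),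
      ← ENNReal.ofReal_mul (by positivity), ← ENNReal.ofReal_mul (by positivity)]
    congr 1; field_simp
  rw [setLIntegral_congr_fun measurableSet_Ioi h1, lintegral_const_mul' _ _ ENNReal.ofReal_ne_top,
    lintegral_lintegral_swap (by fun_prop)]
  have h2 : ∀ t ∈ Ioi (0:ℝ), ∫⁻ w in Ioi (0:ℝ), ENNReal.ofReal (w^(z-1) * (t^(a-1) * rexp (-((1+w)*t)))) =
      ENNReal.ofReal (Real.Gamma z) * ENNReal.ofReal (t^(a-z-1) * rexp (-(1*t))) := by
    intro t ht
    have ht : 0 < t := ht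
    have e : ∀ w : ℝ, ENNReal.ofReal (w^(z-1) * (t^(a-1) * rexp (-((1+w)*t)))) =
       ENNReal.ofReal (t^(a-1) * rexp (-t)) * ENNReal.ofReal (w^(z-1) * rexp (-(t*w))) := by
      intro w; rw [← ENNReal.ofReal_mul (by positivity)]
      congr 1
      have : rexp (-((1+w)*t)) = rexp (-t) * rexp (-(t*w)) := by
        rw [← Real.exp_add]; congr 1; ring
      rw [this]; ring
    simp_rw [e]
    rw [lintegral_const_mul' _ _ ENNReal.ofReal_ne_top, gamL z t hz ht,
      ← ENNReal.ofReal_mul (by positivity), ← ENNReal.ofReal_mul (by positivity)]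
    congr 1
    have : t^(a-z-1) = t^(a-1) * (1/t)^z := by
      rw [one_div, Real.inv_rpow ht.le, ← Real.rpow_neg ht.le, ← Real.rpow_add ht]; congr 1; ring
    rw [this, one_mul]; ring
  rw [setLIntegral_congr_fun measurableSet_Ioi h2, lintegral_const_mul' _ _ ENNReal.ofReal_ne_top,
    gamL (a-z) 1 (by linarith) one_pos, ← ENNReal.ofReal_mul (by positivity), ← ENNReal.ofReal_mul (by positivity)]
  congr 1
  simp; ring

noncomputable def TT (z : ℝ) : ℝ := (1+z)*(1-z/2)*Real.Gamma (1-z)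

lemma beta_sum (z : ℝ) (hz : 0 < z) (hz1 : z < 1) :
    ∫⁻ w in Ioi (0:ℝ), ENNReal.ofReal (w^(z-1) * (1/(1+w) + w/(1+w)^3)) = ENNReal.ofReal (Real.Gamma z * TT z) := by
  have hGz := Real.Gamma_pos_of_pos hz
  have h1 : ∀ w ∈ Ioi (0:ℝ), ENNReal.ofReal (w^(z-1) * (1/(1+w) + w/(1+w)^3)) =
      ENNReal.ofReal (w^(z-1) * (1/(1+w))^(1:ℝ)) + ENNReal.ofReal (w^((z+1)-1) * (1/(1+w))^(3:ℝ)) := by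
    intro w hw
    have hw : 0 < w := hw
    rw [← ENNReal.ofReal_add (by positivity) (by positivity)]
    congr 1
    have e3 : (1/(1+w))^(3:ℝ) = (1/(1+w))^3 := by exact_mod_cast Real.rpow_natCast (1/(1+w)) 3
    have e1 : w^((z+1)-1) = w^(z-1) * w := by
      rw [← Real.rpow_add_one hw.ne']; congr 1; ring
    rw [Real.rpow_one, e3, e1]; field_simp
  rw [setLIntegral_congr_fun measurableSet_Ioi h1, lintegral_add_left (by fun_prop), betaL z 1 hz hz1,
    betaL (z+1) 3 (by linarith) (by linarith)]
  have hG3 : Real.Gamma 3 = 2 := by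
    rw [show (3:ℝ) = (2:ℕ) + 1 by norm_num, Real.Gamma_nat_eq_factorial]; norm_num
  have hG2 : Real.Gamma (3-(z+1)) = (1-z) * Real.Gamma (1-z) := by
    rw [← Real.Gamma_add_one (by linarith)]; congr 1; ring
  have hG1z := Real.Gamma_pos_of_pos (show 0 < 1 - z by linarith)
  have : 0 < 1 - z := by linarith
  rw [hG3, hG2, Real.Gamma_add_one hz.ne', Real.Gamma_one, ← ENNReal.ofReal_add (by positivity) (by positivity)]
  congr 1
  unfold TT; ring

lemma kap_nonneg (w : ℝ) : 0 ≤ kap w := by unfold kap; split_ifs <;> positivity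

lemma meas_kap : Measurable kap := by
  unfold kap
  apply Measurable.ite measurableSet_Iic <;> fun_prop

noncomputable def KK (z : ℝ) : ENNReal := ∫⁻ w in Ioi (0:ℝ), ENNReal.ofReal (w^(z-1) * kap w)

lemma KK_ne_top (z : ℝ) (hz : 0 < z) (hz1 : z < 1) : KK z ≠ ⊤ := by
  have h : KK z ≤ ENNReal.ofReal 36 * ∫⁻ w in Ioi (0:ℝ), ENNReal.ofReal (w^(z-1) * (1/(1+w))^(2:ℝ)) := by
    unfold KK
    rw [← lintegral_const_mul' _ _ ENNReal.ofReal_ne_top]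
    apply setLIntegral_mono' measurableSet_Ioi
    intro w hw
    have hw : 0 < w := hw
    rw [← ENNReal.ofReal_mul (by positivity)]
    apply ENNReal.ofReal_le_ofReal
    have e3 : (1/(1+w))^(2:ℝ) = (1/(1+w))^2 := by exact_mod_cast Real.rpow_natCast (1/(1+w)) 2
    rw [e3]
    have : kap w ≤ 36 * (1/(1+w))^2 := by
      unfold kap
      rw [div_pow, one_pow, mul_one_div]
      split_ifs with h1
      · rw [le_div_iff₀ (by positivity)]; nlinarith
      · push Not at h1
        rw [div_le_div_iff₀ (by positivity) (by positivity)]; nlinarith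
    calc w^(z-1) * kap w ≤ w^(z-1) * (36 * (1/(1+w))^2) := by gcongr
      _ = _ := by ring
  rw [betaL z 2 hz (by linarith), ← ENNReal.ofReal_mul (by norm_num)] at h
  exact (h.trans_lt ENNReal.ofReal_lt_top).ne

lemma hm_cont (m : ℕ) : Continuous (hm m) := by
  unfold hm
  have := cont_aR m
  have := cont_bR m
  fun_prop

noncomputable def LL (z : ℝ) (m : ℕ) : ENNReal := ∫⁻ w in Ioi (0:ℝ), ENNReal.ofReal (w^(z-1) * (hm m w + kap w))

lemma exists_m (z : ℝ) (hz : 0 < z) (hz1 : z < 1) :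
    ∃ m : ℕ, 0 < m ∧ KK z + ENNReal.ofReal (Real.Gamma z * TT z) < LL z m := by
  have hmk := meas_kap
  have hstep : KK z + ENNReal.ofReal (Real.Gamma z * TT z) <
      Filter.liminf (fun m => LL z m) Filter.atTop := by
    have hF : ∫⁻ w in Ioi (0:ℝ), Filter.liminf (fun m => ENNReal.ofReal (w^(z-1) * (hm m w + kap w))) Filter.atTop ≤
      Filter.liminf (fun m => LL z m) Filter.atTop := by
      apply lintegral_liminf_le
      intro m
      have := (hm_cont m).measurable
      fun_prop
    refine lt_of_lt_of_le ?_ hF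
    rw [← beta_sum z hz hz1, KK, ← lintegral_add_left (by fun_prop)]
    apply lintegral_strict_mono
    · simp
    · apply Measurable.aemeasurable
      apply Measurable.liminf
      intro m
      have := (hm_cont m).measurable
      fun_prop
    · rw [lintegral_add_left (by fun_prop), beta_sum z hz hz1]
      exact ENNReal.add_ne_top.mpr ⟨KK_ne_top z hz hz1, ENNReal.ofReal_ne_top⟩
    · filter_upwards [self_mem_ae_restrict measurableSet_Ioi] with w hw
      have hw : 0 < w := hw
      have hk := kap_nonneg w
      rw [← ENNReal.ofReal_add (by positivity) (by positivity), ← mul_add]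
      have ht : Filter.Tendsto (fun m : ℕ => ENNReal.ofReal (w^(z-1) * (1 + (max (lo m w) 0)^2 - th w ^ 2 + kap w)))
          Filter.atTop (nhds (ENNReal.ofReal (w^(z-1) * (1 + 1/w - th w ^ 2 + kap w)))) := by
        apply ENNReal.tendsto_ofReal
        apply Filter.Tendsto.const_mul
        exact ((tendsto_const_nhds.add (lo_nonneg_tendsto w hw)).sub tendsto_const_nhds).add tendsto_const_nhds
      have h1 : ENNReal.ofReal (w^(z-1) * (1 + 1/w - th w ^ 2 + kap w)) ≤
          Filter.liminf (fun m => ENNReal.ofReal (w^(z-1) * (hm m w + kap w))) Filter.atTop := by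
        rw [← ht.liminf_eq]
        refine Filter.liminf_le_liminf ?_
        filter_upwards [Filter.eventually_gt_atTop 0] with m hm0
        have := hm_lower m hm0 w hw
        gcongr
      refine lt_of_lt_of_le ?_ h1
      have := th_main hw
      have hwz : 0 < w^(z-1) := by positivity
      have hp : 0 < 1/(1+w) + w/(1+w)^3 := by positivity
      rw [ENNReal.ofReal_lt_ofReal_iff (mul_pos hwz (by linarith))]
      apply mul_lt_mul_of_pos_left _ hwz
      linarith
  have := (Filter.eventually_lt_of_lt_liminf hstep).and (Filter.eventually_gt_atTop 0)
  obtain ⟨m, h1, h2⟩ := this.exists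
  exact ⟨m, h2, h1⟩

noncomputable def Sq (m : ℕ) : Set (ℝ × ℝ) := Ico (0:ℝ) m ×ˢ Ico (0:ℝ) m

noncomputable def AA (z : ℝ) (m : ℕ) : ENNReal :=
  ∫⁻ p in Sq m, ∫⁻ q in Sq m, (ENNReal.ofReal ((p.1-q.1)^2 + (p.2-q.2)^2))^(-z)

noncomputable def BB (z : ℝ) (m : ℕ) : ℝ :=
  ∑ i : Fin m × Fin m, ∑ j : Fin m × Fin m, if i = j then 0 else
    ((((i.1:ℕ):ℝ) - ((j.1:ℕ):ℝ))^2 + (((i.2:ℕ):ℝ) - ((j.2:ℕ):ℝ))^2) ^ (-z)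

lemma ofReal_aR (m : ℕ) (w : ℝ) :
    ∫⁻ x in Ico (0:ℝ) m, ∫⁻ y in Ico (0:ℝ) m, ENNReal.ofReal (rexp (-π*w*(x-y)^2)) = ENNReal.ofReal (aR m w) := by
  have hm : (0:ℝ) ≤ m := by positivity
  have h1 : ∀ x : ℝ, ∫⁻ y in Ico (0:ℝ) m, ENNReal.ofReal (rexp (-π*w*(x-y)^2)) =
      ENNReal.ofReal (∫ y in (0:ℝ)..m, rexp (-π*w*(x-y)^2)) := by
    intro x
    rw [intervalIntegral.integral_of_le hm, ofReal_integral_eq_lintegral_ofReal, restrict_Ico_eq_restrict_Ioc]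
    · have : Continuous (fun y : ℝ => rexp (-π*w*(x-y)^2)) := by fun_prop
      exact this.integrableOn_Ioc
    · exact Filter.Eventually.of_forall (fun y => (Real.exp_pos _).le)
  simp_rw [h1]
  unfold aR
  rw [intervalIntegral.integral_of_le hm, ofReal_integral_eq_lintegral_ofReal, restrict_Ico_eq_restrict_Ioc]
  · exact (cont_inner w 0 m).integrableOn_Ioc
  · refine Filter.Eventually.of_forall (fun x => ?_)
    apply intervalIntegral.integral_nonneg hm
    intro y _; positivity

lemma ofReal_aR_sq (m : ℕ) (w : ℝ) :
    ∫⁻ p in Sq m, ∫⁻ q in Sq m, ENNReal.ofReal (rexp (-(π*((p.1-q.1)^2 + (p.2-q.2)^2)*w))) = ENNReal.ofReal (aR m w ^ 2) := by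
  unfold Sq
  rw [Measure.volume_eq_prod, ← Measure.prod_restrict]
  have h1 : ∀ p : ℝ × ℝ, ∫⁻ q, ENNReal.ofReal (rexp (-(π*((p.1-q.1)^2 + (p.2-q.2)^2)*w)))
      ∂((volume.restrict (Ico (0:ℝ) m)).prod (volume.restrict (Ico (0:ℝ) m))) =
      (∫⁻ y in Ico (0:ℝ) m, ENNReal.ofReal (rexp (-π*w*(p.1-y)^2))) *
      (∫⁻ y in Ico (0:ℝ) m, ENNReal.ofReal (rexp (-π*w*(p.2-y)^2))) := by
    intro p
    rw [← lintegral_prod_mul (by fun_prop) (by fun_prop)]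
    congr 1; ext q
    rw [← ENNReal.ofReal_mul (by positivity), ← Real.exp_add]; congr 2; ring
  simp_rw [h1]
  have hme : Measurable (fun x : ℝ => ∫⁻ y in Ico (0:ℝ) m, ENNReal.ofReal (rexp (-π*w*(x-y)^2))) := by
    apply Measurable.lintegral_prod_right' (f := fun p : ℝ × ℝ => ENNReal.ofReal (rexp (-π*w*(p.1-p.2)^2)))
    fun_prop
  rw [lintegral_prod_mul hme.aemeasurable hme.aemeasurable, ofReal_aR, ← ENNReal.ofReal_mul (aR_nonneg m w), sq]

lemma pow_rep (z : ℝ) (hz : 0 < z) (D : ℝ) (hD : 0 < D) :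
    ENNReal.ofReal (π^z / Real.Gamma z) * ∫⁻ w in Ioi (0:ℝ), ENNReal.ofReal (w^(z-1) * rexp (-(π*D*w))) = ENNReal.ofReal (D^(-z)) := by
  have hG := Real.Gamma_pos_of_pos hz
  rw [gamL z (π*D) hz (by positivity), ← ENNReal.ofReal_mul (by positivity)]
  congr 1
  rw [one_div, Real.inv_rpow (by positivity), Real.mul_rpow Real.pi_pos.le hD.le, Real.rpow_neg hD.le]
  field_simp

lemma AA_lower (z : ℝ) (hz : 0 < z) (m : ℕ) :
    ENNReal.ofReal (π^z / Real.Gamma z) * ∫⁻ w in Ioi (0:ℝ), ENNReal.ofReal (w^(z-1) * aR m w ^ 2) ≤ AA z m := by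
  have h1 : ∀ w ∈ Ioi (0:ℝ), ENNReal.ofReal (w^(z-1) * aR m w ^ 2) =
      ∫⁻ p in Sq m, ∫⁻ q in Sq m, ENNReal.ofReal (w^(z-1) * rexp (-(π*((p.1-q.1)^2 + (p.2-q.2)^2)*w))) := by
    intro w hw
    have hw : 0 < w := hw
    rw [ENNReal.ofReal_mul (by positivity), ← ofReal_aR_sq]
    rw [← lintegral_const_mul' _ _ ENNReal.ofReal_ne_top]
    congr 1; ext p
    rw [← lintegral_const_mul' _ _ ENNReal.ofReal_ne_top]
    congr 1; ext q
    rw [← ENNReal.ofReal_mul (by positivity)]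
  have hmeas : Measurable (fun x : ℝ × (ℝ × ℝ) × (ℝ × ℝ) => ENNReal.ofReal (x.1^(z-1) * rexp (-(π*((x.2.1.1-x.2.2.1)^2 + (x.2.1.2-x.2.2.2)^2)*x.1)))) := by
    fun_prop
  rw [setLIntegral_congr_fun measurableSet_Ioi h1, lintegral_lintegral_swap]
  · rw [← lintegral_const_mul' _ _ ENNReal.ofReal_ne_top]
    unfold AA
    apply lintegral_mono
    intro p
    beta_reduce
    rw [lintegral_lintegral_swap]
    · rw [← lintegral_const_mul' _ _ ENNReal.ofReal_ne_top]
      apply lintegral_mono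
      intro q
      simp only
      have hD : 0 ≤ (p.1-q.1)^2 + (p.2-q.2)^2 := by positivity
      rcases hD.eq_or_lt with h0 | h0
      · rw [← h0, ENNReal.ofReal_zero, ENNReal.zero_rpow_of_neg (by linarith)]; exact le_top
      · rw [pow_rep z hz _ h0, ENNReal.ofReal_rpow_of_pos h0]
    · apply Measurable.aemeasurable
      exact hmeas.comp (g := _) (f := fun x : ℝ × (ℝ × ℝ) => (x.1, p, x.2)) (by fun_prop)
  · apply Measurable.aemeasurable
    apply Measurable.lintegral_prod_right' (f := fun y : (ℝ × (ℝ × ℝ)) × (ℝ × ℝ) => ENNReal.ofReal (y.1.1^(z-1) * rexp (-(π*((y.1.2.1-y.2.1)^2 + (y.1.2.2-y.2.2)^2)*y.1.1))))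
    fun_prop

lemma bR_sq (m : ℕ) (w : ℝ) : bR m w ^ 2 - (m:ℝ)^2 =
    ∑ i : Fin m × Fin m, ∑ j : Fin m × Fin m, if i = j then 0 else
      rexp (-(π * ((((i.1:ℕ):ℝ) - ((j.1:ℕ):ℝ))^2 + (((i.2:ℕ):ℝ) - ((j.2:ℕ):ℝ))^2) * w)) := by
  have h1 : bR m w = ∑ i : Fin m, ∑ j : Fin m, rexp (-π * w * (((i:ℕ):ℝ)-((j:ℕ):ℝ))^2) := by
    unfold bR
    rw [Finset.sum_range]
    refine Finset.sum_congr rfl (fun i _ => ?_)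
    rw [Finset.sum_range]
  have h2 : bR m w ^ 2 = ∑ i : Fin m × Fin m, ∑ j : Fin m × Fin m,
      rexp (-(π * ((((i.1:ℕ):ℝ) - ((j.1:ℕ):ℝ))^2 + (((i.2:ℕ):ℝ) - ((j.2:ℕ):ℝ))^2) * w)) := by
    rw [sq, h1, Finset.sum_mul_sum, Fintype.sum_prod_type]
    refine Finset.sum_congr rfl (fun i _ => Finset.sum_congr rfl (fun i' _ => ?_))
    rw [Finset.sum_mul_sum, Fintype.sum_prod_type]
    refine Finset.sum_congr rfl (fun j _ => Finset.sum_congr rfl (fun j' _ => ?_))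
    rw [← Real.exp_add]; congr 1; ring
  have h3 : (m:ℝ)^2 = ∑ i : Fin m × Fin m, ∑ j : Fin m × Fin m, if i = j then (1:ℝ) else 0 := by
    simp [sq]
  rw [h2, h3, ← Finset.sum_sub_distrib]
  refine Finset.sum_congr rfl (fun i _ => ?_)
  rw [← Finset.sum_sub_distrib]
  refine Finset.sum_congr rfl (fun j _ => ?_)
  split_ifs with h
  · subst h; simp
  · simp

lemma BB_eq (z : ℝ) (hz : 0 < z) (m : ℕ) :
    ENNReal.ofReal (π^z / Real.Gamma z) * ∫⁻ w in Ioi (0:ℝ), ENNReal.ofReal (w^(z-1) * (bR m w ^ 2 - (m:ℝ)^2)) = ENNReal.ofReal (BB z m) := by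
  have h1 : ∀ w ∈ Ioi (0:ℝ), ENNReal.ofReal (w^(z-1) * (bR m w ^ 2 - (m:ℝ)^2)) =
      ∑ i : Fin m × Fin m, ∑ j : Fin m × Fin m, if i = j then 0 else
      ENNReal.ofReal (w^(z-1) * rexp (-(π * ((((i.1:ℕ):ℝ) - ((j.1:ℕ):ℝ))^2 + (((i.2:ℕ):ℝ) - ((j.2:ℕ):ℝ))^2) * w))) := by
    intro w hw
    have hw : 0 < w := hw
    rw [bR_sq, Finset.mul_sum, ENNReal.ofReal_sum_of_nonneg]
    · refine Finset.sum_congr rfl (fun i _ => ?_)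
      rw [Finset.mul_sum, ENNReal.ofReal_sum_of_nonneg]
      · refine Finset.sum_congr rfl (fun j _ => ?_)
        split_ifs <;> simp
      · intro j _; split_ifs <;> positivity
    · intro i _
      apply mul_nonneg (by positivity)
      apply Finset.sum_nonneg
      intro j _; split_ifs <;> positivity
  rw [setLIntegral_congr_fun measurableSet_Ioi h1, lintegral_finsetSum _ (by
    intro i _
    apply Finset.measurable_fun_sum
    intro j _; split_ifs <;> fun_prop), Finset.mul_sum]
  unfold BB
  rw [ENNReal.ofReal_sum_of_nonneg]
  · refine Finset.sum_congr rfl (fun i _ => ?_)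
    rw [lintegral_finsetSum _ (by intro j _; split_ifs <;> fun_prop), Finset.mul_sum, ENNReal.ofReal_sum_of_nonneg]
    · refine Finset.sum_congr rfl (fun j _ => ?_)
      split_ifs with h
      · simp
      · rw [pow_rep z hz]
        by_contra hn
        apply h
        have h1 : (((i.1:ℕ):ℝ) - ((j.1:ℕ):ℝ))^2 ≤ 0 := by nlinarith [sq_nonneg (((i.2:ℕ):ℝ) - ((j.2:ℕ):ℝ))]
        have h2 : (((i.2:ℕ):ℝ) - ((j.2:ℕ):ℝ))^2 ≤ 0 := by nlinarith [sq_nonneg (((i.1:ℕ):ℝ) - ((j.1:ℕ):ℝ))]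
        have h1' := sub_eq_zero.mp (pow_eq_zero_iff (two_ne_zero) |>.mp (le_antisymm h1 (sq_nonneg _)))
        have h2' := sub_eq_zero.mp (pow_eq_zero_iff (two_ne_zero) |>.mp (le_antisymm h2 (sq_nonneg _)))
        ext
        · exact_mod_cast h1'
        · exact_mod_cast h2'
    · intro j _; split_ifs <;> positivity
  · intro i _
    apply Finset.sum_nonneg
    intro j _; split_ifs <;> positivity

lemma BB_nonneg (z : ℝ) (m : ℕ) : 0 ≤ BB z m := by
  unfold BB
  apply Finset.sum_nonneg; intro i _
  apply Finset.sum_nonneg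
  intro j _; split_ifs <;> positivity

lemma TT_pos (z : ℝ) (hz : 0 < z) (hz1 : z < 1) : 0 < TT z := by
  have hG1z := Real.Gamma_pos_of_pos (show 0 < 1 - z by linarith)
  have : 0 < 1 - z/2 := by linarith
  unfold TT; positivity

theorem local_main (z : ℝ) (hz : 0 < z) (hz1 : z < 1) :
    ∃ m : ℕ, 0 < m ∧ ENNReal.ofReal (BB z m + (m:ℝ)^2 * π^z * TT z) < AA z m := by
  obtain ⟨m, hm0, h⟩ := exists_m z hz hz1
  refine ⟨m, hm0, ?_⟩
  have hmk := meas_kap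
  have hGz := Real.Gamma_pos_of_pos hz
  have hT := TT_pos z hz hz1
  have hB := BB_nonneg z m
  have hm' : (0:ℝ) < m := by exact_mod_cast hm0
  have ma := (cont_aR m).measurable
  have mb := (cont_bR m).measurable
  have mh := (hm_cont m).measurable
  set c := ENNReal.ofReal (π^z / Real.Gamma z) with hc
  set M := ENNReal.ofReal ((m:ℝ)^2) with hM
  have hid : c * (∫⁻ w in Ioi (0:ℝ), ENNReal.ofReal (w^(z-1) * aR m w ^ 2)) + c * (M * KK z) =
      c * (M * LL z m) + ENNReal.ofReal (BB z m) := by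
    rw [← BB_eq z hz m, ← mul_add, ← mul_add]
    congr 1
    rw [KK, LL, ← lintegral_const_mul' _ _ ENNReal.ofReal_ne_top, ← lintegral_const_mul' _ _ ENNReal.ofReal_ne_top,
      ← lintegral_add_left (by fun_prop), ← lintegral_add_left (by fun_prop)]
    apply setLIntegral_congr_fun measurableSet_Ioi
    intro w hw
    have hw : 0 < w := hw
    have hk := kap_nonneg w
    have h1 := hm_kap m hm0 w hw
    have h2 : 0 ≤ bR m w ^ 2 - (m:ℝ)^2 := by
      have := b_ge_m m w
      nlinarith
    simp only
    rw [← ENNReal.ofReal_mul (by positivity), ← ENNReal.ofReal_mul (by positivity),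
      ← ENNReal.ofReal_add (by positivity) (by positivity), ← ENNReal.ofReal_add (by positivity) (by positivity)]
    congr 1
    unfold hm
    field_simp
    ring
  have hc0 : c ≠ 0 := by rw [hc]; simp; positivity
  have hM0 : M ≠ 0 := by rw [hM]; simp; positivity
  have hlt : c * (M * (KK z + ENNReal.ofReal (Real.Gamma z * TT z))) < c * (M * LL z m) := by
    apply (ENNReal.mul_lt_mul_iff_right hc0 ENNReal.ofReal_ne_top).mpr
    apply (ENNReal.mul_lt_mul_iff_right hM0 ENNReal.ofReal_ne_top).mpr h
  have hK : c * (M * KK z) ≠ ⊤ :=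
    ENNReal.mul_ne_top ENNReal.ofReal_ne_top (ENNReal.mul_ne_top ENNReal.ofReal_ne_top (KK_ne_top z hz hz1))
  have hlt2 := ENNReal.add_lt_add_left (a := ENNReal.ofReal (BB z m)) ENNReal.ofReal_ne_top hlt
  rw [add_comm, add_comm _ (c * (M * LL z m)), ← hid, mul_add, mul_add, add_comm (c * (M * KK z)), add_right_comm] at hlt2
  have hlt3 := lt_of_add_lt_add_right hlt2
  refine lt_of_le_of_lt (le_of_eq ?_) (hlt3.trans_le (AA_lower z hz m))
  rw [hc, hM, ← ENNReal.ofReal_mul (by positivity), ← ENNReal.ofReal_mul (by positivity), ← ENNReal.ofReal_add (by positivity) hB]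
  congr 1
  field_simp
  ring

end RB

namespace RB
open MeasureTheory
open Set

abbrev E3 := EuclideanSpace ℝ (Fin 3)

lemma meas_vec {α : Type*} [MeasurableSpace α] {a b c : α → ℝ} (ha : Measurable a) (hb : Measurable b) (hc : Measurable c) :
    Measurable (fun x => (!₂[a x, b x, c x] : E3)) := by
  have : Measurable (fun x => (![a x, b x, c x] : Fin 3 → ℝ)) := by
    rw [measurable_pi_iff]; intro i; fin_cases i <;> simpa
  exact (MeasurableEquiv.toLp 2 (Fin 3 → ℝ)).measurable.comp this

lemma e3_int (f : E3 → ENNReal) (hf : Measurable f) :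
    ∫⁻ v, f v = ∫⁻ z : ℝ, ∫⁻ q : ℝ × ℝ, f !₂[q.1, q.2, z] := by
  rw [← (PiLp.volume_preserving_toLp (Fin 3)).lintegral_comp hf]
  have h1 := (volume_preserving_piFinSuccAbove (fun _ : Fin 3 => ℝ) 2)
  have h2 := (MeasurePreserving.id (volume : Measure ℝ)).prod (volume_preserving_finTwoArrow ℝ)
  have h3 := h2.comp h1
  have hm : Measurable (fun x : ℝ × (ℝ × ℝ) => f !₂[x.2.1, x.2.2, x.1]) :=
    hf.comp (meas_vec (by fun_prop) (by fun_prop) (by fun_prop))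
  have h4 := h3.lintegral_comp hm
  rw [← Measure.volume_eq_prod, Measure.volume_eq_prod, lintegral_prod _ hm.aemeasurable] at h4
  rw [← h4]
  congr 1; ext x
  congr 2
  ext i
  fin_cases i <;> rfl

lemma cyl (g : ℝ × ℝ → ENNReal) (hg : Measurable g) :
    ∫⁻ q, g q = ∫⁻ ρ in Ioi (0:ℝ), ∫⁻ φ in Ioo (-π) π, ENNReal.ofReal ρ * g (ρ * cos φ, ρ * sin φ) := by
  rw [← lintegral_comp_polarCoord_symm, polarCoord_target, Measure.volume_eq_prod, setLIntegral_prod]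
  · rfl
  · apply Measurable.aemeasurable
    simp only [polarCoord_symm_apply, smul_eq_mul]
    exact (by fun_prop : Measurable (fun p : ℝ × ℝ => ENNReal.ofReal p.1)).mul (hg.comp (by fun_prop))

lemma half_int (G : ℝ × ℝ → ENNReal) (hG : Measurable G) :
    ∫⁻ z : ℝ, ∫⁻ ρ in Ioi (0:ℝ), ENNReal.ofReal ρ * G (z, ρ) =
      ∫⁻ r in Ioi (0:ℝ), ∫⁻ t in Ioo (-1:ℝ) 1, ENNReal.ofReal (r^2) * G (r*t, r * √(1-t^2)) := by
  set H : ℝ × ℝ → ENNReal := fun q => (Ioi (0:ℝ)).indicator (fun ρ => ENNReal.ofReal ρ * G (q.1, ρ)) q.2 with hH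
  have hHm : Measurable H := by
    have : H = (univ ×ˢ Ioi (0:ℝ)).indicator (fun q : ℝ × ℝ => ENNReal.ofReal q.2 * G (q.1, q.2)) := by
      ext q; simp [hH, indicator]
    rw [this]
    apply Measurable.indicator _ (MeasurableSet.univ.prod measurableSet_Ioi)
    exact (by fun_prop : Measurable (fun p : ℝ × ℝ => ENNReal.ofReal p.2)).mul hG
  have h1 : ∫⁻ z : ℝ, ∫⁻ ρ in Ioi (0:ℝ), ENNReal.ofReal ρ * G (z, ρ) = ∫⁻ q, H q := by
    rw [Measure.volume_eq_prod, lintegral_prod _ hHm.aemeasurable]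
    congr 1; ext z
    rw [← lintegral_indicator measurableSet_Ioi]
  rw [h1, cyl H hHm]
  apply setLIntegral_congr_fun measurableSet_Ioi
  intro r hr
  have hr : 0 < r := hr
  have himg : Set.image cos (Ioo 0 π) = Ioo (-1) 1 := by
    ext t
    constructor
    · rintro ⟨θ, hθ, rfl⟩
      have hs := Real.sin_pos_of_mem_Ioo hθ
      constructor <;> nlinarith [Real.sin_sq_add_cos_sq θ]
    · intro ht
      refine ⟨arccos t, ⟨?_, ?_⟩, Real.cos_arccos ht.1.le ht.2.le⟩
      · exact Real.arccos_pos.mpr ht.2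
      · exact Real.arccos_lt_pi.mpr ht.1
  simp only
  rw [← himg, lintegral_image_eq_lintegral_abs_deriv_mul measurableSet_Ioo
    (fun x _ => (Real.hasDerivAt_cos x).hasDerivWithinAt) (Real.injOn_cos.mono Ioo_subset_Icc_self)]
  rw [← lintegral_indicator measurableSet_Ioo, ← lintegral_indicator measurableSet_Ioo]
  congr 1; ext θ
  simp only [hH]
  by_cases h : θ ∈ Ioo 0 π
  · have hs := Real.sin_pos_of_mem_Ioo h
    have h' : θ ∈ Ioo (-π) π := ⟨by linarith [h.1, Real.pi_pos], h.2⟩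
    rw [indicator_of_mem h, indicator_of_mem h', indicator_of_mem (by simp; positivity)]
    have e : √(1 - cos θ ^ 2) = sin θ := by
      rw [← Real.sin_sq, Real.sqrt_sq hs.le]
    rw [e, abs_neg, abs_of_pos hs, ← mul_assoc, ← mul_assoc, ← ENNReal.ofReal_mul hr.le, ← ENNReal.ofReal_mul hs.le]
    congr 2; ring
  · rw [indicator_of_notMem h]
    by_cases h' : θ ∈ Ioo (-π) π
    · rw [indicator_of_mem h', indicator_of_notMem, mul_zero]
      simp only [mem_Ioi, not_lt]
      have : θ ≤ 0 := by
        by_contra hn; push Not at hn; exact h ⟨hn, h'.2⟩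
      have := Real.sin_nonpos_of_nonpos_of_neg_pi_le this h'.1.le
      nlinarith
    · rw [indicator_of_notMem h']

noncomputable def PP (p : ℝ × ℝ) : E3 := !₂[√(1-p.1^2) * cos p.2, √(1-p.1^2) * sin p.2, p.1]

lemma meas_PP : Measurable PP := by
  unfold PP
  exact meas_vec (by fun_prop) (by fun_prop) (by fun_prop)

lemma norm_PP (p : ℝ × ℝ) (hp : p.1 ∈ Icc (-1:ℝ) 1) : ‖PP p‖ = 1 := by
  have h : 0 ≤ 1 - p.1^2 := by nlinarith [hp.1, hp.2]
  rw [EuclideanSpace.norm_eq, Fin.sum_univ_three]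
  simp only [PP, Real.norm_eq_abs, sq_abs]
  simp only [Matrix.cons_val, mul_pow, Real.sq_sqrt h]
  rw [Real.sqrt_eq_one]
  nlinarith [Real.sin_sq_add_cos_sq p.2]

noncomputable def RR : Set (ℝ × ℝ) := Ico (-1:ℝ) 1 ×ˢ Ico (-π) π

lemma ae_RR (f : ℝ × ℝ → ENNReal) (hf : Measurable f) :
    ∫⁻ p in RR, f p = ∫⁻ t in Ioo (-1:ℝ) 1, ∫⁻ φ in Ioo (-π) π, f (t, φ) := by
  unfold RR
  rw [Measure.volume_eq_prod, setLIntegral_prod _ hf.aemeasurable]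
  simp_rw [restrict_Ico_eq_restrict_Ioc, ← restrict_Ioo_eq_restrict_Ioc]

lemma sph_int (f : E3 → ENNReal) (hf : Measurable f) :
    ∫⁻ v, f v = ∫⁻ r in Ioi (0:ℝ), ENNReal.ofReal (r^2) * ∫⁻ p in RR, f (r • PP p) := by
  have hm3 : Measurable (fun x : (ℝ × ℝ) × ℝ => f !₂[x.1.2 * cos x.2, x.1.2 * sin x.2, x.1.1]) :=
    hf.comp (meas_vec (by fun_prop) (by fun_prop) (by fun_prop))
  set G : ℝ × ℝ → ENNReal := fun q => ∫⁻ φ in Ioo (-π) π, f !₂[q.2 * cos φ, q.2 * sin φ, q.1] with hG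
  have hGm : Measurable G := Measurable.lintegral_prod_right' hm3
  rw [e3_int f hf]
  have h1 : ∀ z : ℝ, ∫⁻ q : ℝ × ℝ, f !₂[q.1, q.2, z] = ∫⁻ ρ in Ioi (0:ℝ), ENNReal.ofReal ρ * G (z, ρ) := by
    intro z
    have hmz : Measurable (fun q : ℝ × ℝ => f !₂[q.1, q.2, z]) :=
      hf.comp (meas_vec (by fun_prop) (by fun_prop) (by fun_prop))
    rw [cyl _ hmz]
    simp_rw [lintegral_const_mul' _ _ ENNReal.ofReal_ne_top]
    rfl
  simp_rw [h1]
  rw [half_int G hGm]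
  congr 1; ext r
  rw [lintegral_const_mul' _ _ ENNReal.ofReal_ne_top, ae_RR]
  · congr 1; congr 1; ext t
    simp only [hG]
    congr 1; ext φ
    congr 1
    ext i
    fin_cases i <;> simp [PP, mul_assoc]
  · exact hf.comp (meas_PP.const_smul r)

lemma sph_ker (F : ℝ → ENNReal) (hF : Measurable F) (e : E3) :
    ∫⁻ v : E3, ENNReal.ofReal (rexp (-‖v‖)) * F (inner ℝ v e / ‖v‖) =
      ENNReal.ofReal 2 * ∫⁻ p in RR, F (inner ℝ (PP p) e) := by
  rw [sph_int _ (by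
    have h1 : Measurable (fun v : E3 => inner ℝ v e) := by fun_prop
    have := hF.comp (h1.div (measurable_norm))
    exact Measurable.mul (by fun_prop) this)]
  have h2 : ∀ r ∈ Ioi (0:ℝ), ENNReal.ofReal (r^2) * ∫⁻ p in RR, ENNReal.ofReal (rexp (-‖r • PP p‖)) * F (inner ℝ (r • PP p) e / ‖r • PP p‖)
     = ENNReal.ofReal (r^((3:ℝ)-1) * rexp (-(1*r))) * ∫⁻ p in RR, F (inner ℝ (PP p) e) := by
    intro r hr
    have hr : 0 < r := hr
    have : ∀ p ∈ RR, ENNReal.ofReal (rexp (-‖r • PP p‖)) * F (inner ℝ (r • PP p) e / ‖r • PP p‖) =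
        ENNReal.ofReal (rexp (-r)) * F (inner ℝ (PP p) e) := by
      intro p hp
      have hn := norm_PP p ⟨hp.1.1, hp.1.2.le⟩
      rw [norm_smul, hn, inner_smul_left]
      simp only [norm_eq_abs, abs_of_pos hr, mul_one]
      congr 2
      simp; field_simp
    rw [setLIntegral_congr_fun (by unfold RR; measurability) this, lintegral_const_mul' _ _ ENNReal.ofReal_ne_top,
      ← mul_assoc, ← ENNReal.ofReal_mul (by positivity)]
    congr 3
    · norm_num
    · simp
  rw [setLIntegral_congr_fun measurableSet_Ioi h2, lintegral_mul_const _ (by fun_prop), gamL 3 1 (by norm_num) (by norm_num)]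
  congr 2
  have hG3 : Real.Gamma 3 = 2 := by
    rw [show (3:ℝ) = (2:ℕ) + 1 by norm_num, Real.Gamma_nat_eq_factorial]; norm_num
  rw [hG3]; norm_num

lemma rot_inv (F : ℝ → ENNReal) (hF : Measurable F) (e e' : E3) (h : ‖e‖ = ‖e'‖) :
    ∫⁻ p in RR, F (inner ℝ (PP p) e) = ∫⁻ p in RR, F (inner ℝ (PP p) e') := by
  have h1 := sph_ker F hF e
  have h2 := sph_ker F hF e'
  set U := (ℝ ∙ (e - e'))ᗮ.reflection with hU
  have hUe : U e = e' := Submodule.reflection_sub h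
  have h3 := (LinearIsometryEquiv.measurePreserving U).lintegral_comp_emb U.toHomeomorph.measurableEmbedding
    (fun v : E3 => ENNReal.ofReal (rexp (-‖v‖)) * F (inner ℝ v e' / ‖v‖))
  have h4 : ∀ v, inner ℝ (U v) e' = inner ℝ v e := by
    intro v; rw [← hUe, LinearIsometryEquiv.inner_map_map]
  simp only [LinearIsometryEquiv.norm_map, h4] at h3
  rw [h1, h2] at h3
  exact (ENNReal.mul_right_inj (by simp) ENNReal.ofReal_ne_top).mp h3

lemma sph_total (z : ℝ) (hz : 0 < z) (hz1 : z < 1) (e : E3) (he : ‖e‖ = 1) :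
    ∫⁻ p in RR, (ENNReal.ofReal (2 - 2 * inner ℝ (PP p) e))^(-z) = ENNReal.ofReal (4*π*(2^(1-2*z)/(2-2*z))) := by
  have hF : Measurable (fun t : ℝ => (ENNReal.ofReal (2 - 2*t))^(-z)) := by fun_prop
  set e0 : E3 := !₂[0,0,1] with he0
  have hn : ‖e0‖ = 1 := by
    rw [EuclideanSpace.norm_eq, Fin.sum_univ_three]; simp [he0]
  have h1 := rot_inv _ hF e e0 (he.trans hn.symm)
  rw [h1]
  have h2 : ∀ p, inner ℝ (PP p) e0 = p.1 := by
    intro p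
    simp [PP, he0, PiLp.inner_apply, Fin.sum_univ_three]
  simp_rw [h2]
  rw [ae_RR _ (by fun_prop)]
  simp only [lintegral_const, Measure.restrict_apply MeasurableSet.univ, univ_inter, Real.volume_Ioo]
  rw [lintegral_mul_const _ (by fun_prop)]
  have h3 : ∫⁻ t in Ioo (-1:ℝ) 1, (ENNReal.ofReal (2-2*t))^(-z) = ENNReal.ofReal (4^(1-z)/(2*(1-z))) := by
    have e1 : ∀ t ∈ Ioo (-1:ℝ) 1, (ENNReal.ofReal (2-2*t))^(-z) = ENNReal.ofReal ((2-2*t)^(-z)) := by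
      intro t ht
      rw [ENNReal.ofReal_rpow_of_pos (by linarith [ht.2])]
    rw [setLIntegral_congr_fun measurableSet_Ioo e1, restrict_Ioo_eq_restrict_Ioc]
    have hi : IntervalIntegrable (fun x : ℝ => x^(-z)) volume 0 4 := intervalIntegral.intervalIntegrable_rpow' (by linarith)
    have hii : IntervalIntegrable (fun t : ℝ => (2-2*t)^(-z)) volume (-1) 1 := by
      have := (hi.comp_mul_left (c := (2:ℝ))).comp_sub_left 1
      norm_num at this
      convert this.symm using 2
      ring
    rw [← ofReal_integral_eq_lintegral_ofReal ((intervalIntegrable_iff_integrableOn_Ioc_of_le (by norm_num)).mp hii), ← intervalIntegral.integral_of_le (by norm_num)]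
    · congr 1
      have := intervalIntegral.integral_comp_sub_mul (f := fun x : ℝ => x^(-z)) (a := -1) (b := 1) (c := 2) (by norm_num) 2
      rw [this]
      norm_num
      rw [integral_rpow (by left; linarith), Real.zero_rpow (by linarith)]
      have : 1 - z ≠ 0 := by linarith
      rw [show -z+1 = 1-z by ring]
      field_simp
      ring
    · filter_upwards [self_mem_ae_restrict measurableSet_Ioc] with t ht
      have : 0 ≤ 2-2*t := by linarith [ht.2]
      simp only [Pi.zero_apply]; positivity
  have hz' : 0 < 1 - z := by linarith
  rw [h3, ← ENNReal.ofReal_mul (by positivity)]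
  congr 1
  have e4 : (4:ℝ)^(1-z) = 2 * 2^(1-2*z) := by
    rw [show (4:ℝ) = 2^(2:ℝ) by norm_num, ← Real.rpow_mul (by norm_num)]
    rw [← Real.rpow_one_add' (by norm_num) (by linarith)]
    congr 1; ring
  rw [e4, show 2 - 2*z = 2*(1-z) by ring]
  field_simp
  ring

end RB

namespace RB
open MeasureTheory
open Set

lemma avg {X β J : Type} [MeasurableSpace X] [Fintype β] [DecidableEq β] [Fintype J] [DecidableEq J]
    (b : J → β) (μ : β → Measure X) [∀ i, IsProbabilityMeasure (μ i)] (T : J → X → X) (hT : ∀ j, Measurable (T j))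
    (G : X → X → ENNReal) (hG : Measurable (Function.uncurry G)) (S : Set X)
    (hS : ∀ j, ∀ᵐ u ∂μ (b j), T j u ∈ S) :
    ∃ ω : β → X, (∀ j, T j (ω (b j)) ∈ S) ∧
      ∑ i, ∑ j, (if i = j then 0 else G (T i (ω (b i))) (T j (ω (b j)))) ≤
      ∑ i, ∑ j, (if i = j then 0 else if b i = b j then ∫⁻ u, G (T i u) (T j u) ∂μ (b i)
        else ∫⁻ u, ∫⁻ v, G (T i u) (T j v) ∂μ (b j) ∂μ (b i)) := by
  have hae : ∀ᵐ ω ∂(Measure.pi μ), ∀ j, T j (ω (b j)) ∈ S := by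
    rw [ae_all_iff]
    intro j
    exact (Measure.quasiMeasurePreserving_eval μ (b j)).ae (hS j)
  have hGT : ∀ i j, Measurable (fun p : X × X => G (T i p.1) (T j p.2)) := by
    intro i j
    exact hG.comp (((hT i).comp measurable_fst).prodMk ((hT j).comp measurable_snd))
  have hterm : ∀ i j, Measurable (fun ω : β → X => G (T i (ω (b i))) (T j (ω (b j)))) := by
    intro i j
    exact (hGT i j).comp (f := fun ω : β → X => (ω (b i), ω (b j))) ((measurable_pi_apply (b i)).prodMk (measurable_pi_apply (b j)))
  have hterm' : ∀ i j, Measurable (fun ω : β → X => if i = j then 0 else G (T i (ω (b i))) (T j (ω (b j)))) := by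
    intro i j
    split_ifs
    · exact measurable_const
    · exact hterm i j
  set f : (β → X) → ENNReal := fun ω => ∑ i, ∑ j, (if i = j then 0 else G (T i (ω (b i))) (T j (ω (b j)))) with hf
  have hfm : Measurable f := Finset.measurable_fun_sum _ (fun i _ => Finset.measurable_fun_sum _ (fun j _ => hterm' i j))
  obtain ⟨ω, hω, hle⟩ := exists_notMem_null_le_lintegral (μ := Measure.pi μ) hfm.aemeasurable (ae_iff.mp hae)
  refine ⟨ω, by simpa using hω, hle.trans (le_of_eq ?_)⟩
  rw [hf, lintegral_finsetSum _ (fun i _ => Finset.measurable_fun_sum _ (fun j _ => hterm' i j))]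
  refine Finset.sum_congr rfl (fun i _ => ?_)
  rw [lintegral_finsetSum _ (fun j _ => hterm' i j)]
  refine Finset.sum_congr rfl (fun j _ => ?_)
  split_ifs with h1 h2
  · simp
  · rw [← h2]
    have hm : Measurable (fun u : X => G (T i u) (T j u)) := (hGT i j).comp (measurable_id.prodMk measurable_id)
    exact (measurePreserving_eval μ (b i)).lintegral_comp hm
  · have hind := ProbabilityTheory.iIndepFun_pi (μ := μ) (X := fun _ x => x) (fun _ => measurable_id.aemeasurable)
    have h3 := hind.indepFun h2
    rw [ProbabilityTheory.indepFun_iff_map_prod_eq_prod_map_map (measurable_pi_apply _).aemeasurable (measurable_pi_apply _).aemeasurable] at h3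
    have e1 : Measure.map (fun ω : β → X => ω (b i)) (Measure.pi μ) = μ (b i) := (measurePreserving_eval μ (b i)).map_eq
    have e2 : Measure.map (fun ω : β → X => ω (b j)) (Measure.pi μ) = μ (b j) := (measurePreserving_eval μ (b j)).map_eq
    rw [e1, e2] at h3
    rw [← lintegral_prod _ (hGT i j).aemeasurable, ← h3, lintegral_map (hGT i j) ((measurable_pi_apply (b i)).prodMk (measurable_pi_apply (b j)))]

/-- Averaging with the diagonal blocks put back. -/
lemma avg2 {X β J : Type} [MeasurableSpace X] [Fintype β] [DecidableEq β] [Fintype J] [DecidableEq J]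
    (b : J → β) (μ : β → Measure X) [∀ i, IsProbabilityMeasure (μ i)] (T : J → X → X) (hT : ∀ j, Measurable (T j))
    (G : X → X → ENNReal) (hG : Measurable (Function.uncurry G)) (S : Set X)
    (hS : ∀ j, ∀ᵐ u ∂μ (b j), T j u ∈ S) :
    ∃ ω : β → X, (∀ j, T j (ω (b j)) ∈ S) ∧
      ∑ i, ∑ j, (if i = j then 0 else G (T i (ω (b i))) (T j (ω (b j)))) +
       ∑ i, ∑ j, (if b i = b j then ∫⁻ u, ∫⁻ v, G (T i u) (T j v) ∂μ (b j) ∂μ (b i) else 0) ≤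
      ∑ i, ∑ j, ∫⁻ u, ∫⁻ v, G (T i u) (T j v) ∂μ (b j) ∂μ (b i) + 
      ∑ i, ∑ j, (if i = j then 0 else if b i = b j then ∫⁻ u, G (T i u) (T j u) ∂μ (b i) else 0) := by
  obtain ⟨ω, h1, h2⟩ := avg b μ T hT G hG S hS
  refine ⟨ω, h1, (add_le_add_left h2 _).trans (le_of_eq ?_)⟩
  simp only [← Finset.sum_add_distrib]
  refine Finset.sum_congr rfl (fun i _ => Finset.sum_congr rfl (fun j _ => ?_))
  by_cases hij : i = j
  · subst hij; simp
  · by_cases hb : b i = b j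
    · simp [hij, hb, add_comm]
    · simp [hij, hb]

end RB

namespace RB
open MeasureTheory
open Set

lemma aff1 (g : ℝ → ENNReal) (z a L : ℝ) (ha : 0 < a) :
    ∫⁻ x in Ico z (z + a * L), g x = ENNReal.ofReal a * ∫⁻ t in Ico 0 L, g (z + a * t) := by
  have himg : Set.image (fun t : ℝ => z + a * t) (Ico 0 L) = Ico z (z + a * L) := by
    ext x
    constructor
    · rintro ⟨t, ht, rfl⟩
      exact ⟨by nlinarith [ht.1], by nlinarith [ht.2]⟩
    · intro hx
      refine ⟨(x - z)/a, ⟨div_nonneg (by linarith [hx.1]) ha.le, ?_⟩, ?_⟩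
      · rw [div_lt_iff₀ ha]; nlinarith [hx.2]
      · field_simp; ring
  have hinj : InjOn (fun t : ℝ => z + a * t) (Ico 0 L) := by
    intro x _ y _ hxy
    simp only [add_right_inj, mul_eq_mul_left_iff] at hxy
    exact hxy.resolve_right ha.ne'
  rw [← himg, lintegral_image_eq_lintegral_abs_deriv_mul (f' := fun _ => a) measurableSet_Ico _ hinj,
    lintegral_const_mul' _ _ ENNReal.ofReal_ne_top, abs_of_pos ha]
  intro x _
  have := ((hasDerivAt_id x).const_mul a).const_add z
  simp only [mul_one] at this
  exact this.hasDerivWithinAt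

lemma sum1 (g : ℝ → ENNReal) (m : ℕ) :
    ∑ i : Fin m, ∫⁻ t in Ico (0:ℝ) 1, g (t + (i:ℕ)) = ∫⁻ t in Ico (0:ℝ) m, g t := by
  rw [← Finset.sum_range (fun i : ℕ => ∫⁻ t in Ico (0:ℝ) 1, g (t + i))]
  induction m with
  | zero => simp
  | succ k ih =>
    rw [Finset.sum_range_succ, ih]
    have h1 : Ico (0:ℝ) ((k+1 : ℕ):ℝ) = Ico (0:ℝ) k ∪ Ico (k:ℝ) (k + 1 * 1) := by
      rw [Ico_union_Ico_eq_Ico (by positivity) (by linarith)]; push_cast; rw [one_mul]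
    rw [h1, lintegral_union measurableSet_Ico (by
      rw [Ico_disjoint_Ico]; simp), aff1 g k 1 1 one_pos]
    simp [add_comm]

lemma sum2 (F : ℝ × ℝ → ENNReal) (hF : Measurable F) (m : ℕ) :
    ∑ i : Fin m × Fin m, ∫⁻ u in Sq 1, F (u.1 + (i.1:ℕ), u.2 + (i.2:ℕ)) = ∫⁻ p in Sq m, F p := by
  unfold Sq
  rw [Measure.volume_eq_prod, setLIntegral_prod _ hF.aemeasurable, Fintype.sum_prod_type,
    ← sum1 (fun x => ∫⁻ y in Ico (0:ℝ) m, F (x, y)) m]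
  refine Finset.sum_congr rfl (fun i _ => ?_)
  have : ∀ j : Fin m, ∫⁻ u in Ico (0:ℝ) ((1:ℕ):ℝ) ×ˢ Ico (0:ℝ) ((1:ℕ):ℝ), F (u.1 + (i:ℕ), u.2 + (j:ℕ)) ∂(volume.prod volume) =
      ∫⁻ x in Ico (0:ℝ) 1, ∫⁻ y in Ico (0:ℝ) 1, F (x + (i:ℕ), y + (j:ℕ)) := by
    intro j
    have hm : Measurable (fun u : ℝ × ℝ => F (u.1 + (i:ℕ), u.2 + (j:ℕ))) := hF.comp (by fun_prop)
    rw [setLIntegral_prod _ hm.aemeasurable]; simp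
  simp_rw [this]
  have hm2 : ∀ j : Fin m, Measurable (fun x => ∫⁻ y in Ico (0:ℝ) 1, F (x + (i:ℕ), y + (j:ℕ))) := by
    intro j
    apply Measurable.lintegral_prod_right' (f := fun u : ℝ × ℝ => F (u.1 + (i:ℕ), u.2 + (j:ℕ)))
    exact hF.comp (by fun_prop)
  rw [← lintegral_finsetSum _ (fun j _ => hm2 j)]
  congr 1; ext x
  rw [← sum1]

noncomputable def Amap (h z φ ρ : ℝ) (p : ℝ × ℝ) : ℝ × ℝ := (z + h * ρ * p.1, φ + h / ρ * p.2)

noncomputable def Qset (m : ℕ) (h z φ ρ : ℝ) : Set (ℝ × ℝ) :=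
  Ico z (z + h * ρ * m) ×ˢ Ico φ (φ + h / ρ * m)

lemma meas_A (h z φ ρ : ℝ) : Measurable (Amap h z φ ρ) := by unfold Amap; fun_prop

lemma meas_Q (m : ℕ) (h z φ ρ : ℝ) : MeasurableSet (Qset m h z φ ρ) := measurableSet_Ico.prod measurableSet_Ico

lemma A_mem (m : ℕ) (h z φ ρ : ℝ) (hh : 0 < h) (hρ : 0 < ρ) (p : ℝ × ℝ) (hp : p ∈ Sq m) : Amap h z φ ρ p ∈ Qset m h z φ ρ := by
  obtain ⟨⟨a, b⟩, c, d⟩ := hp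
  have h1 : 0 < h * ρ := by positivity
  have h2 : 0 < h / ρ := by positivity
  refine ⟨⟨?_, ?_⟩, ?_, ?_⟩ <;> simp only [Amap] <;> nlinarith

lemma aff2 (F : ℝ × ℝ → ENNReal) (hF : Measurable F) (m : ℕ) (h z φ ρ : ℝ) (hh : 0 < h) (hρ : 0 < ρ) :
    ∫⁻ p in Qset m h z φ ρ, F p = ENNReal.ofReal (h^2) * ∫⁻ p in Sq m, F (Amap h z φ ρ p) := by
  unfold Qset Sq
  have hm : Measurable (fun p => F (Amap h z φ ρ p)) := hF.comp (meas_A h z φ ρ)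
  rw [Measure.volume_eq_prod, setLIntegral_prod _ hF.aemeasurable, setLIntegral_prod _ hm.aemeasurable,
    aff1 _ z (h*ρ) m (by positivity)]
  simp_rw [aff1 _ φ (h/ρ) m (by positivity)]
  rw [lintegral_const_mul' _ _ ENNReal.ofReal_ne_top, ← mul_assoc, ← ENNReal.ofReal_mul (by positivity)]
  congr 2
  field_simp

lemma vol_Sq1 : volume (Sq 1) = 1 := by
  unfold Sq; rw [Measure.volume_eq_prod, Measure.prod_prod]; simp

lemma vol_RR : volume RR = ENNReal.ofReal (4*π) := by
  unfold RR; rw [Measure.volume_eq_prod, Measure.prod_prod, Real.volume_Ico, Real.volume_Ico, ← ENNReal.ofReal_mul (by norm_num)]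
  congr 1; ring

lemma vol_Q (m : ℕ) (h z φ ρ : ℝ) (hh : 0 < h) (hρ : 0 < ρ) : volume (Qset m h z φ ρ) = ENNReal.ofReal (h^2 * m^2) := by
  unfold Qset; rw [Measure.volume_eq_prod, Measure.prod_prod, Real.volume_Ico, Real.volume_Ico, ← ENNReal.ofReal_mul (by ring_nf; positivity)]
  congr 1; field_simp; ring

lemma meas_RR : MeasurableSet RR := measurableSet_Ico.prod measurableSet_Ico

noncomputable def GG (z : ℝ) (p q : ℝ × ℝ) : ENNReal := (ENNReal.ofReal (2 - 2 * inner ℝ (PP p) (PP q)))^(-z)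

lemma meas_GG (z : ℝ) : Measurable (Function.uncurry (GG z)) := by
  have h1 : Measurable (fun x : (ℝ × ℝ) × (ℝ × ℝ) => inner ℝ (PP x.1) (PP x.2)) :=
    (meas_PP.comp measurable_fst).inner (meas_PP.comp measurable_snd)
  have : Measurable (fun x : (ℝ × ℝ) × (ℝ × ℝ) => (ENNReal.ofReal (2 - 2 * inner ℝ (PP x.1) (PP x.2)))^(-z)) := by
    fun_prop
  exact this

end RB

namespace RB
open MeasureTheory
open Set

noncomputable def D2 (p q : ℝ × ℝ) : ℝ := (p.1-q.1)^2 + (p.2-q.2)^2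

lemma meas_Sq (m : ℕ) : MeasurableSet (Sq m) := measurableSet_Ico.prod measurableSet_Ico

lemma cellA (z : ℝ) (hz : 0 < z) (m : ℕ) (h ε : ℝ) (hh : 0 < h) (hε : 0 < ε) (A : ℝ × ℝ → ℝ × ℝ)
    (hgeo : ∀ p ∈ Sq m, ∀ q ∈ Sq m, 2 - 2 * inner ℝ (PP (A p)) (PP (A q)) ≤ (1+ε) * h^2 * D2 p q) :
    ENNReal.ofReal (((1+ε)*h^2)^(-z)) * AA z m ≤ ∫⁻ p in Sq m, ∫⁻ q in Sq m, GG z (A p) (A q) := by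
  unfold AA
  rw [← lintegral_const_mul' _ _ ENNReal.ofReal_ne_top]
  apply setLIntegral_mono' (meas_Sq m)
  intro p hp
  rw [← lintegral_const_mul' _ _ ENNReal.ofReal_ne_top]
  apply setLIntegral_mono' (meas_Sq m)
  intro q hq
  unfold GG
  rw [← ENNReal.ofReal_rpow_of_pos (by positivity), ← ENNReal.mul_rpow_of_ne_top ENNReal.ofReal_ne_top ENNReal.ofReal_ne_top,
    ← ENNReal.ofReal_mul (by positivity), ENNReal.rpow_neg, ENNReal.rpow_neg]
  have := hgeo p hp q hq
  unfold D2 at this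
  gcongr

lemma cellB (z : ℝ) (hz : 0 < z) (m : ℕ) (h ε : ℝ) (hh : 0 < h) (hε : ε < 1) (A : ℝ × ℝ → ℝ × ℝ)
    (hgeo : ∀ p ∈ Sq m, ∀ q ∈ Sq m, (1-ε) * h^2 * D2 p q ≤ 2 - 2 * inner ℝ (PP (A p)) (PP (A q))) :
    ∑ i : Fin m × Fin m, ∑ j : Fin m × Fin m, (if i = j then 0 else
      ∫⁻ u in Sq 1, GG z (A (u.1 + (i.1:ℕ), u.2 + (i.2:ℕ))) (A (u.1 + (j.1:ℕ), u.2 + (j.2:ℕ)))) ≤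
      ENNReal.ofReal (((1-ε)*h^2)^(-z) * BB z m) := by
  have he : 0 < 1 - ε := by linarith
  unfold BB
  rw [Finset.mul_sum, ENNReal.ofReal_sum_of_nonneg (by
    intro i _
    apply mul_nonneg (by positivity)
    apply Finset.sum_nonneg
    intro j _; split_ifs <;> positivity)]
  refine Finset.sum_le_sum (fun i _ => ?_)
  rw [Finset.mul_sum, ENNReal.ofReal_sum_of_nonneg (by
    intro j _; split_ifs <;> positivity)]
  refine Finset.sum_le_sum (fun j _ => ?_)
  split_ifs with hij
  · simp
  have hmem : ∀ u ∈ Sq 1, ∀ i : Fin m × Fin m, ((u.1 + ((i.1:ℕ):ℝ), u.2 + ((i.2:ℕ):ℝ)) : ℝ × ℝ) ∈ Sq m := by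
    intro u hu i
    obtain ⟨⟨a, b⟩, c, d⟩ := hu
    have h1 : ((i.1:ℕ):ℝ) + 1 ≤ m := by exact_mod_cast i.1.2
    have h2 : ((i.2:ℕ):ℝ) + 1 ≤ m := by exact_mod_cast i.2.2
    have h3 : (0:ℝ) ≤ ((i.1:ℕ):ℝ) := by positivity
    have h4 : (0:ℝ) ≤ ((i.2:ℕ):ℝ) := by positivity
    push_cast at b d
    refine ⟨⟨?_, ?_⟩, ?_, ?_⟩ <;> simp only <;> linarith
  set D := ((((i.1:ℕ):ℝ) - ((j.1:ℕ):ℝ))^2 + (((i.2:ℕ):ℝ) - ((j.2:ℕ):ℝ))^2) with hD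
  have hDpos : 0 < D := by
    by_contra hn
    apply hij
    have h1 : (((i.1:ℕ):ℝ) - ((j.1:ℕ):ℝ))^2 ≤ 0 := by nlinarith [sq_nonneg (((i.2:ℕ):ℝ) - ((j.2:ℕ):ℝ))]
    have h2 : (((i.2:ℕ):ℝ) - ((j.2:ℕ):ℝ))^2 ≤ 0 := by nlinarith [sq_nonneg (((i.1:ℕ):ℝ) - ((j.1:ℕ):ℝ))]
    have h1' := sub_eq_zero.mp (pow_eq_zero_iff (two_ne_zero) |>.mp (le_antisymm h1 (sq_nonneg _)))
    have h2' := sub_eq_zero.mp (pow_eq_zero_iff (two_ne_zero) |>.mp (le_antisymm h2 (sq_nonneg _)))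
    ext
    · exact_mod_cast h1'
    · exact_mod_cast h2'
  have hle : ∀ u ∈ Sq 1, GG z (A (u.1 + (i.1:ℕ), u.2 + (i.2:ℕ))) (A (u.1 + (j.1:ℕ), u.2 + (j.2:ℕ))) ≤
      ENNReal.ofReal (((1-ε)*h^2)^(-z) * D^(-z)) := by
    intro u hu
    have h1 := hgeo _ (hmem u hu i) _ (hmem u hu j)
    have h2 : D2 (u.1 + ((i.1:ℕ):ℝ), u.2 + ((i.2:ℕ):ℝ)) (u.1 + ((j.1:ℕ):ℝ), u.2 + ((j.2:ℕ):ℝ)) = D := by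
      simp only [D2, hD]; ring
    rw [h2] at h1
    unfold GG
    rw [← Real.mul_rpow (by positivity) hDpos.le, ← ENNReal.ofReal_rpow_of_pos (by positivity),
      ENNReal.rpow_neg, ENNReal.rpow_neg]
    gcongr
  refine (setLIntegral_mono' (meas_Sq 1) hle).trans ?_
  simp [vol_Sq1]

lemma meas_gen {X : Type} [MeasurableSpace X] (G : X → X → ENNReal) (hG : Measurable (Function.uncurry G))
    (A B : X → X) (hA : Measurable A) (hB : Measurable B) :
    Measurable (fun x : X × X => G (A x.1) (B x.2)) :=
  hG.comp ((hA.comp measurable_fst).prodMk (hB.comp measurable_snd))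

lemma meas_GG1 (z : ℝ) (u : ℝ × ℝ) : Measurable (GG z u) :=
  (meas_GG z).of_uncurry_left

lemma meas_GG2 (z : ℝ) (u : ℝ × ℝ) (A : ℝ × ℝ → ℝ × ℝ) (hA : Measurable A) : Measurable (fun q => GG z u (A q)) :=
  (meas_GG1 z u).comp hA

lemma meas_GG3 (z : ℝ) (A B : ℝ × ℝ → ℝ × ℝ) (hA : Measurable A) (hB : Measurable B) :
    Measurable (fun x : (ℝ × ℝ) × (ℝ × ℝ) => GG z (A x.1) (B x.2)) :=
  meas_gen (GG z) (meas_GG z) A B hA hB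

lemma meas_GG4 (z : ℝ) (A B : ℝ × ℝ → ℝ × ℝ) (hA : Measurable A) (hB : Measurable B) (ν : Measure (ℝ × ℝ)) [SFinite ν] :
    Measurable (fun p => ∫⁻ q, GG z (A p) (B q) ∂ν) :=
  (meas_GG3 z A B hA hB).lintegral_prod_right'

lemma sph_GG (z : ℝ) (hz : 0 < z) (hz1 : z < 1) (u : ℝ × ℝ) (hu : u ∈ RR) :
    ∫⁻ q in RR, GG z u q = ENNReal.ofReal (4*π*(2^(1-2*z)/(2-2*z))) := by
  rw [← sph_total z hz hz1 (PP u) (norm_PP _ ⟨hu.1.1, hu.1.2.le⟩)]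
  exact lintegral_congr (fun q => by unfold GG; rw [real_inner_comm])

lemma tot_aux {X β J : Type} [MeasurableSpace X] [Fintype β] [Fintype J]
    (b : J → β) (μ : β → Measure X) [∀ i, IsProbabilityMeasure (μ i)] (T : J → X → X) (hT : ∀ j, Measurable (T j))
    (G : X → X → ENNReal) (hG : Measurable (Function.uncurry G)) (S : Set X)
    (hS : ∀ j, ∀ᵐ u ∂μ (b j), T j u ∈ S) (K : ENNReal)
    (hK : ∀ u ∈ S, ∑ j, ∫⁻ v, G u (T j v) ∂μ (b j) = K) :
    ∑ i, ∑ j, ∫⁻ u, ∫⁻ v, G (T i u) (T j v) ∂μ (b j) ∂μ (b i) = (Fintype.card J : ENNReal) * K := by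
  have h1 : ∀ i, ∑ j, ∫⁻ u, ∫⁻ v, G (T i u) (T j v) ∂μ (b j) ∂μ (b i) = K := by
    intro i
    rw [← lintegral_finsetSum]
    · have h2 : ∀ᵐ u ∂μ (b i), ∑ j, ∫⁻ v, G (T i u) (T j v) ∂μ (b j) = K := by
        filter_upwards [hS i] with u hu
        exact hK _ hu
      rw [lintegral_congr_ae h2, lintegral_const]
      simp
    · intro j _
      apply Measurable.lintegral_prod_right' (f := fun x : X × X => G (T i x.1) (T j x.2))
      exact hG.comp (((hT i).comp measurable_fst).prodMk ((hT j).comp measurable_snd))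
  simp_rw [h1]
  rw [Finset.sum_const, Finset.card_univ, nsmul_eq_mul]

set_option maxHeartbeats 1600000 in
theorem exists_configuration (z : ℝ) (hz : 0 < z) (hz1 : z < 1) (m N : ℕ) (hm : 0 < m) (hN : 0 < N) (h ε : ℝ) (hh : 0 < h)
    (hhN : h^2 = 4*π/N) (hε : 0 < ε) (hε1 : ε < 1)
    {C : Type} [Fintype C] [DecidableEq C] (zc fc rc : C → ℝ) (hr : ∀ c, 0 < rc c)
    (hQ : ∀ c, Qset m h (zc c) (fc c) (rc c) ⊆ RR)
    (hdisj : Pairwise (fun c c' => Disjoint (Qset m h (zc c) (fc c) (rc c)) (Qset m h (zc c') (fc c') (rc c'))))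
    (hgeo1 : ∀ c, ∀ p ∈ Sq m, ∀ q ∈ Sq m, (1-ε) * h^2 * D2 p q ≤
      2 - 2 * inner ℝ (PP (Amap h (zc c) (fc c) (rc c) p)) (PP (Amap h (zc c) (fc c) (rc c) q)))
    (hgeo2 : ∀ c, ∀ p ∈ Sq m, ∀ q ∈ Sq m,
      2 - 2 * inner ℝ (PP (Amap h (zc c) (fc c) (rc c) p)) (PP (Amap h (zc c) (fc c) (rc c) q)) ≤ (1+ε) * h^2 * D2 p q) :
    ∃ x : Fin N → E3, (∀ i, ‖x i‖ = 1) ∧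
      ∑ i, ∑ j, (if i = j then 0 else (ENNReal.ofReal (2 - 2 * inner ℝ (x i) (x j)))^(-z)) +
        Fintype.card C * (ENNReal.ofReal (((1+ε)*h^2)^(-z)) * AA z m) ≤
      ENNReal.ofReal (2^(1-2*z)/(2-2*z) * (N:ℝ)^2) + Fintype.card C * ENNReal.ofReal (((1-ε)*h^2)^(-z) * BB z m) := by
  have hN' : (0:ℝ) < N := by exact_mod_cast hN
  have hz' : 0 < 2 - 2*z := by linarith
  set Q : C → Set (ℝ × ℝ) := fun c => Qset m h (zc c) (fc c) (rc c) with hQdef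
  set V : Set (ℝ × ℝ) := ⋃ c ∈ (Finset.univ : Finset C), Q c with hV
  have hVm : MeasurableSet V := Finset.measurableSet_biUnion _ (fun c _ => meas_Q _ _ _ _ _)
  have hVint : ∀ F : ℝ × ℝ → ENNReal, ∫⁻ p in V, F p = ∑ c, ∫⁻ p in Q c, F p := by
    intro F
    exact lintegral_biUnion_finset (fun c _ c' _ hne => hdisj hne) (fun c _ => meas_Q _ _ _ _ _) F
  have hVR : V ⊆ RR := by
    rw [hV]; exact iUnion₂_subset (fun c _ => hQ c)
  have hVvol : volume V = ENNReal.ofReal (Fintype.card C * (h^2 * m^2)) := by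
    have := hVint (fun _ => 1)
    simp only [setLIntegral_const, one_mul, hQdef] at this
    rw [this]
    simp_rw [vol_Q m h _ _ _ hh (hr _)]
    rw [Finset.sum_const, Finset.card_univ, nsmul_eq_mul, ENNReal.ofReal_mul (p := (Fintype.card C : ℝ)) (by positivity), ENNReal.ofReal_natCast]
  set U := RR \ V with hU
  have hUm : MeasurableSet U := meas_RR.diff hVm
  have hUint : ∀ F : ℝ × ℝ → ENNReal, ∫⁻ p in RR, F p = (∑ c, ∫⁻ p in Q c, F p) + ∫⁻ p in U, F p := by
    intro F
    rw [← hVint, ← lintegral_union hUm disjoint_sdiff_right, hU, union_sdiff_cancel hVR]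
  have hcard : Fintype.card C * m^2 ≤ N := by
    have h1 : volume V ≤ volume RR := measure_mono hVR
    rw [hVvol, vol_RR, ENNReal.ofReal_le_ofReal_iff (by positivity), hhN] at h1
    have h2 : (Fintype.card C : ℝ) * m^2 ≤ N := by
      have : (Fintype.card C : ℝ) * (4*π/N * m^2) = (Fintype.card C * m^2) * (4*π) / N := by ring
      rw [this, div_le_iff₀ hN'] at h1
      have hpi := Real.pi_pos
      nlinarith
    exact_mod_cast h2
  obtain ⟨l, hl⟩ := Nat.exists_eq_add_of_le hcard
  have hl' : (N:ℝ) = Fintype.card C * m^2 + l := by exact_mod_cast hl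
  have hUvol : volume U = ENNReal.ofReal (l * h^2) := by
    rw [hU, measure_sdiff hVR hVm.nullMeasurableSet (by rw [hVvol]; exact ENNReal.ofReal_ne_top), hVvol, vol_RR,
      ← ENNReal.ofReal_sub _ (by positivity)]
    congr 1
    have : 4 * π = h^2 * N := by rw [hhN]; field_simp
    rw [this, hl']; ring
  let b : (C × (Fin m × Fin m)) ⊕ Fin l → C ⊕ Fin l := Sum.map Prod.fst id
  let μ : C ⊕ Fin l → Measure (ℝ × ℝ) := Sum.elim (fun _ => volume.restrict (Sq 1)) (fun _ => ProbabilityTheory.cond volume U)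
  let T : (C × (Fin m × Fin m)) ⊕ Fin l → ℝ × ℝ → ℝ × ℝ :=
    Sum.elim (fun c u => Amap h (zc c.1) (fc c.1) (rc c.1) (u.1 + (c.2.1:ℕ), u.2 + (c.2.2:ℕ))) (fun _ => id)
  have hprob : ∀ i, IsProbabilityMeasure (μ i) := by
    rintro (c | k)
    · refine ⟨?_⟩
      simp [μ, vol_Sq1]
    · have hl0 : 0 < l := k.pos
      have : (0:ℝ) < l := by exact_mod_cast hl0
      apply ProbabilityTheory.cond_isProbabilityMeasure_of_finite
      · rw [hUvol]; exact (ENNReal.ofReal_pos.mpr (by positivity)).ne'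
      · rw [hUvol]; exact ENNReal.ofReal_ne_top
  have hT : ∀ j, Measurable (T j) := by
    rintro (c | k)
    · exact (meas_A _ _ _ _).comp (by fun_prop)
    · exact measurable_id
  have hS : ∀ j, ∀ᵐ u ∂μ (b j), T j u ∈ RR := by
    rintro (c | k)
    · show ∀ᵐ u ∂(volume.restrict (Sq 1)), _
      filter_upwards [self_mem_ae_restrict (meas_Sq 1)] with u hu
      apply hQ c.1
      apply A_mem _ _ _ _ _ hh (hr _)
      obtain ⟨⟨a, b⟩, c', d⟩ := hu
      have h1 : ((c.2.1:ℕ):ℝ) + 1 ≤ m := by exact_mod_cast c.2.1.2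
      have h2 : ((c.2.2:ℕ):ℝ) + 1 ≤ m := by exact_mod_cast c.2.2.2
      have h3 : (0:ℝ) ≤ ((c.2.1:ℕ):ℝ) := by positivity
      have h4 : (0:ℝ) ≤ ((c.2.2:ℕ):ℝ) := by positivity
      push_cast at b d
      refine ⟨⟨?_, ?_⟩, ?_, ?_⟩ <;> simp only <;> linarith
    · show ∀ᵐ u ∂(ProbabilityTheory.cond volume U), _
      filter_upwards [ProbabilityTheory.ae_cond_mem hUm] with u hu
      exact hu.1
  have hsum : ∀ F : ℝ × ℝ → ENNReal, Measurable F →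
      ∑ j, ∫⁻ u, F (T j u) ∂μ (b j) = ENNReal.ofReal (1/h^2) * ∫⁻ p in RR, F p := by
    intro F hF
    rw [Fintype.sum_sum_type, Fintype.sum_prod_type, hUint, mul_add, Finset.mul_sum]
    congr 1
    · refine Finset.sum_congr rfl (fun c _ => ?_)
      simp only [hQdef]
      rw [aff2 F hF m h _ _ _ hh (hr c), ← mul_assoc, ← ENNReal.ofReal_mul (by positivity),
        one_div_mul_cancel (by positivity), ENNReal.ofReal_one, one_mul]
      exact sum2 (fun p => F (Amap h (zc c) (fc c) (rc c) p)) (hF.comp (meas_A _ _ _ _)) m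
    · rcases Nat.eq_zero_or_pos l with hl0 | hl0
      · subst hl0
        have : volume U = 0 := by rw [hUvol]; simp
        rw [Measure.restrict_eq_zero.mpr this]; simp
      · have hl1 : (0:ℝ) < l := by exact_mod_cast hl0
        have : ∀ k : Fin l, ∫⁻ u, F (T (Sum.inr k) u) ∂μ (b (Sum.inr k)) = (volume U)⁻¹ * ∫⁻ p in U, F p := by
          intro k
          show ∫⁻ u, F u ∂(ProbabilityTheory.cond volume U) = _
          rw [ProbabilityTheory.cond, lintegral_smul_measure, smul_eq_mul]
        simp_rw [this]
        rw [Finset.sum_const, Finset.card_univ, Fintype.card_fin, nsmul_eq_mul, ← mul_assoc, hUvol,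
          ← ENNReal.ofReal_inv_of_pos (by positivity), ← ENNReal.ofReal_natCast, ← ENNReal.ofReal_mul (by positivity)]
        congr 2
        field_simp
  obtain ⟨ω, hω, hle⟩ := avg2 b μ T hT (GG z) (meas_GG z) RR hS
  have htot : ∑ i, ∑ j, ∫⁻ u, ∫⁻ v, GG z (T i u) (T j v) ∂μ (b j) ∂μ (b i) =
      ENNReal.ofReal (2^(1-2*z)/(2-2*z) * (N:ℝ)^2) := by
    rw [tot_aux b μ T hT (GG z) (meas_GG z) RR hS (ENNReal.ofReal (1/h^2 * (4*π*(2^(1-2*z)/(2-2*z)))))]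
    swap
    · intro u hu
      rw [hsum (GG z u) (meas_GG1 z u),
            sph_GG z hz hz1 u hu, ← ENNReal.ofReal_mul (by positivity)]
    rw [← ENNReal.ofReal_natCast, ← ENNReal.ofReal_mul (by positivity)]
    congr 1
    have hJ : Fintype.card ((C × (Fin m × Fin m)) ⊕ Fin l) = N := by
      simp only [Fintype.card_sum, Fintype.card_prod, Fintype.card_fin]; rw [hl]; ring
    rw [hJ, hhN]
    field_simp
  have hself : (Fintype.card C : ENNReal) * (ENNReal.ofReal (((1+ε)*h^2)^(-z)) * AA z m) ≤
      ∑ i, ∑ j, (if b i = b j then ∫⁻ u, ∫⁻ v, GG z (T i u) (T j v) ∂μ (b j) ∂μ (b i) else 0) := by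
    rw [Fintype.sum_sum_type]
    refine le_trans ?_ le_self_add
    rw [Fintype.sum_prod_type, ← nsmul_eq_mul, ← Finset.card_univ, ← Finset.sum_const]
    refine Finset.sum_le_sum (fun c _ => ?_)
    refine (cellA z hz m h ε hh hε _ (hgeo2 c)).trans ?_
    have hm1 := meas_GG4 z _ _ (meas_A h (zc c) (fc c) (rc c)) (meas_A h (zc c) (fc c) (rc c)) (volume.restrict (Sq m))
    rw [← sum2 _ hm1]
    refine Finset.sum_le_sum (fun i _ => ?_)
    rw [Fintype.sum_sum_type]
    refine le_trans ?_ le_self_add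
    rw [Fintype.sum_prod_type]
    refine le_trans ?_ (Finset.single_le_sum (fun _ _ => zero_le) (Finset.mem_univ c))
    have e1 : ∀ j : Fin m × Fin m, b (Sum.inl (c, i)) = b (Sum.inl (c, j)) := fun j => rfl
    rw [Finset.sum_congr rfl (fun j _ => if_pos (e1 j))]
    rw [← lintegral_finsetSum]
    · apply le_of_eq
      show _ = ∫⁻ u in Sq 1, _
      congr 1; ext u
      exact (sum2 _ (meas_GG2 z _ _ (meas_A h (zc c) (fc c) (rc c))) m).symm
    · intro j _
      exact meas_GG4 z _ _ (hT _) (hT _) _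
  have hrem : ∑ i, ∑ j, (if i = j then 0 else if b i = b j then ∫⁻ u, GG z (T i u) (T j u) ∂μ (b i) else 0) ≤
      (Fintype.card C : ENNReal) * ENNReal.ofReal (((1-ε)*h^2)^(-z) * BB z m) := by
    rw [Fintype.sum_sum_type]
    have e2 : ∀ k : Fin l, ∑ j, (if Sum.inr k = j then 0 else if b (Sum.inr k) = b j then ∫⁻ u, GG z (T (Sum.inr k) u) (T j u) ∂μ (b (Sum.inr k)) else 0) = 0 := by
      intro k
      apply Finset.sum_eq_zero
      rintro (c | k') _
      · simp [b]
      · by_cases hk : k = k'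
        · simp [hk]
        · simp [b, hk]
    simp only [e2, Finset.sum_const_zero, add_zero]
    rw [Fintype.sum_prod_type, ← nsmul_eq_mul, ← Finset.card_univ, ← Finset.sum_const]
    refine Finset.sum_le_sum (fun c _ => ?_)
    refine le_trans (le_of_eq ?_) (cellB z hz m h ε hh hε1 _ (hgeo1 c))
    refine Finset.sum_congr rfl (fun i _ => ?_)
    rw [Fintype.sum_sum_type]
    have e3 : ∀ k : Fin l, (if (Sum.inl (c, i) : (C × (Fin m × Fin m)) ⊕ Fin l) = Sum.inr k then 0 else if b (Sum.inl (c,i)) = b (Sum.inr k) then ∫⁻ u, GG z (T (Sum.inl (c,i)) u) (T (Sum.inr k) u) ∂μ (b (Sum.inl (c,i))) else 0) = 0 := by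
      intro k; simp [b]
    simp only [e3, Finset.sum_const_zero, add_zero]
    rw [Fintype.sum_prod_type, Finset.sum_eq_single c]
    · refine Finset.sum_congr rfl (fun j _ => ?_)
      by_cases hij : i = j
      · simp [hij]
      · have : ¬ ((Sum.inl (c, i) : (C × (Fin m × Fin m)) ⊕ Fin l) = Sum.inl (c, j)) := by simp [hij]
        rw [if_neg this, if_neg hij, if_pos (show b (Sum.inl (c, i)) = b (Sum.inl (c, j)) from rfl)]
        rfl
    · intro c' _ hc'
      apply Finset.sum_eq_zero
      intro j _
      simp [b, hc'.symm]
    · simp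
  rw [htot] at hle
  have hJ : Fintype.card ((C × (Fin m × Fin m)) ⊕ Fin l) = N := by
    simp only [Fintype.card_sum, Fintype.card_prod, Fintype.card_fin]; rw [hl]; ring
  let eq := Fintype.equivFinOfCardEq hJ
  refine ⟨fun i => PP (T (eq.symm i) (ω (b (eq.symm i)))), fun i => ?_, ?_⟩
  · have := hω (eq.symm i)
    exact norm_PP _ ⟨this.1.1, this.1.2.le⟩
  · refine le_trans ?_ ((add_le_add_right hself _).trans (hle.trans (add_le_add_right hrem _)))
    apply le_of_eq
    congr 1
    rw [← eq.sum_comp]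
    refine Finset.sum_congr rfl (fun i _ => ?_)
    rw [← eq.sum_comp]
    refine Finset.sum_congr rfl (fun j _ => ?_)
    simp [GG]

end RB

namespace RB
open MeasureTheory
open Set

lemma chord_eq (b c φ ψ : ℝ) (hb : 0 < 1 - b^2) (hc : 0 < 1 - c^2) :
    2 - 2 * inner ℝ (PP (b, φ)) (PP (c, ψ)) =
      (b-c)^2 * (1 + ((b+c)/(√(1-b^2) + √(1-c^2)))^2) + √(1-b^2) * √(1-c^2) * (2 * (1 - cos (φ - ψ))) := by
  have h1 : 0 < √(1-b^2) := Real.sqrt_pos.mpr hb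
  have h2 : 0 < √(1-c^2) := Real.sqrt_pos.mpr hc
  have e1 : √(1-b^2)^2 = 1 - b^2 := Real.sq_sqrt hb.le
  have e2 : √(1-c^2)^2 = 1 - c^2 := Real.sq_sqrt hc.le
  set r := √(1-b^2)
  set t := √(1-c^2)
  have e3 : (b-c)^2 * ((b+c)/(r+t))^2 = (r-t)^2 := by
    rw [div_pow, mul_div_assoc', div_eq_iff (by positivity)]
    have : r^2 - t^2 = c^2 - b^2 := by rw [e1, e2]; ring
    calc (b-c)^2 * (b+c)^2 = (c^2-b^2)^2 := by ring
      _ = (r^2-t^2)^2 := by rw [this]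
      _ = _ := by ring
  have e4 : inner ℝ (PP (b, φ)) (PP (c, ψ)) = r * t * cos (φ - ψ) + b * c := by
    simp only [PP, PiLp.inner_apply, Fin.sum_univ_three, cos_sub]
    simp [r, t]
    ring
  rw [e4, mul_add ((b-c)^2), e3]
  have : (r-t)^2 = (1-b^2) + (1-c^2) - 2*r*t := by rw [← e1, ← e2]; ring
  rw [this]; ring

noncomputable def F1 (x : ℝ × ℝ × ℝ) : ℝ :=
  (1 - x.1^2) * (1 + ((x.2.1+x.2.2)/(√(1-x.2.1^2) + √(1-x.2.2^2)))^2)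
noncomputable def F2 (x : ℝ × ℝ × ℝ) : ℝ := √(1-x.2.1^2) * √(1-x.2.2^2) / (1 - x.1^2)

lemma unif (F : ℝ × ℝ × ℝ → ℝ) (L : ℝ) (hF : ContinuousOn F (Icc (-L) L ×ˢ (Icc (-L) L ×ˢ Icc (-L) L)))
    (h1 : ∀ a ∈ Icc (-L) L, F (a, a, a) = 1) (ε : ℝ) (hε : 0 < ε) :
    ∃ δ > 0, ∀ a ∈ Icc (-L) L, ∀ b ∈ Icc (-L) L, ∀ c ∈ Icc (-L) L, |b - a| < δ → |c - a| < δ → |F (a, b, c) - 1| < ε := by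
  have hK : IsCompact (Icc (-L) L ×ˢ (Icc (-L) L ×ˢ Icc (-L) L)) := isCompact_Icc.prod (isCompact_Icc.prod isCompact_Icc)
  have := hK.uniformContinuousOn_of_continuous hF
  rw [Metric.uniformContinuousOn_iff] at this
  obtain ⟨δ, hδ, h⟩ := this ε hε
  refine ⟨δ, hδ, fun a ha b hb c hc hab hac => ?_⟩
  have := h (a, b, c) ⟨ha, hb, hc⟩ (a, a, a) ⟨ha, ha, ha⟩ (by
    simp only [Prod.dist_eq, dist_self, Real.dist_eq]
    simp [hab, hac])
  rwa [h1 a ha, Real.dist_eq] at this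

lemma one_sub_ge (η a : ℝ) (h0 : 0 < η) (h1 : η < 1) (ha : a ∈ Icc (-(1-η)) (1-η)) : η ≤ 1 - a^2 := by
  have : a^2 ≤ (1-η)^2 := sq_le_sq' ha.1 ha.2
  nlinarith

lemma geo (η ε : ℝ) (h0 : 0 < η) (h1 : η < 1) (hε : 0 < ε) (hε1 : ε < 1) :
    ∃ δ > 0, ∀ a ∈ Icc (-(1-η)) (1-η), ∀ b ∈ Icc (-(1-η)) (1-η), ∀ c ∈ Icc (-(1-η)) (1-η),
      ∀ φ ψ : ℝ, |b - a| < δ → |c - a| < δ → |φ - ψ| < δ →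
      (1-ε) * ((b-c)^2/(1-a^2) + (1-a^2)*(φ-ψ)^2) ≤ 2 - 2 * inner ℝ (PP (b, φ)) (PP (c, ψ)) ∧
      2 - 2 * inner ℝ (PP (b, φ)) (PP (c, ψ)) ≤ (1+ε) * ((b-c)^2/(1-a^2) + (1-a^2)*(φ-ψ)^2) := by
  have hpos : ∀ a ∈ Icc (-(1-η)) (1-η), 0 < 1 - a^2 := fun a ha => lt_of_lt_of_le h0 (one_sub_ge η a h0 h1 ha)
  obtain ⟨δ1, hδ1, hF1⟩ := unif F1 (1-η) (by
    unfold F1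
    refine ContinuousOn.mul (by fun_prop) (continuousOn_const.add (ContinuousOn.pow (ContinuousOn.div (by fun_prop) (by fun_prop) ?_) 2))
    intro x hx
    have := Real.sqrt_pos.mpr (hpos _ hx.2.1)
    have := Real.sqrt_pos.mpr (hpos _ hx.2.2)
    positivity) (by
    intro a ha
    have h3 := hpos a ha
    have h2 := Real.sqrt_pos.mpr h3
    unfold F1
    have : (a + a) / (√(1-a^2) + √(1-a^2)) = a / √(1-a^2) := by rw [← two_mul, ← two_mul, mul_div_mul_left _ _ two_ne_zero]
    simp only [this]
    rw [div_pow, Real.sq_sqrt h3.le]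
    rw [mul_add, mul_div_cancel₀ _ h3.ne']; ring) (ε/2) (by linarith)
  obtain ⟨δ2, hδ2, hF2⟩ := unif F2 (1-η) (by
    unfold F2
    refine ContinuousOn.div (by fun_prop) (by fun_prop) ?_
    intro x hx
    exact (hpos _ hx.1).ne') (by
    intro a ha
    have h3 := hpos a ha
    unfold F2
    simp only
    rw [Real.mul_self_sqrt h3.le, div_self h3.ne']) (ε/2) (by linarith)
  refine ⟨min (min δ1 δ2) (ε/2), by positivity, ?_⟩
  intro a ha b hb c hc φ ψ hab hac hφ
  simp only [lt_min_iff] at hab hac hφ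
  have g1 := abs_lt.mp (hF1 a ha b hb c hc hab.1.1 hac.1.1)
  have g2 := abs_lt.mp (hF2 a ha b hb c hc hab.1.2 hac.1.2)
  have hA := hpos a ha
  have e1 : 2 - 2 * inner ℝ (PP (b, φ)) (PP (c, ψ)) =
      (b-c)^2/(1-a^2) * F1 (a,b,c) + (1-a^2) * (F2 (a,b,c) * (2 * (1 - cos (φ - ψ)))) := by
    rw [chord_eq b c φ ψ (hpos b hb) (hpos c hc)]
    simp only [F1, F2]
    field_simp
  rw [e1]
  set D := φ - ψ
  have c1 : 2 * (1 - cos D) ≤ D^2 := by linarith [Real.one_sub_sq_div_two_le_cos (x := D)]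
  have hD1 : |D| ≤ 1 := by linarith [hφ.2]
  have hD2 : D^2 ≤ ε/2 := by
    rw [← sq_abs]; nlinarith [abs_nonneg D, hφ.2]
  have c2 : (1 - ε/2) * D^2 ≤ 2 * (1 - cos D) := by
    have := abs_le.mp (Real.cos_bound hD1)
    have e4 : |D|^4 = D^2 * D^2 := by rw [← sq_abs]; ring
    rw [e4] at this
    nlinarith [this.2, sq_nonneg D, mul_nonneg (sq_nonneg D) (sub_nonneg.mpr hD2)]
  have c0 : 0 ≤ 2 * (1 - cos D) := by linarith [Real.cos_le_one D]
  set X := (b-c)^2/(1-a^2)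
  have hX : 0 ≤ X := by positivity
  set W := 2 * (1 - cos D)
  set f1 := F1 (a,b,c)
  set f2 := F2 (a,b,c)
  have k1 : (1-ε) * D^2 ≤ f2 * W := by
    calc (1-ε) * D^2 ≤ (1-ε/2) * ((1-ε/2) * D^2) := by nlinarith [sq_nonneg D, mul_nonneg (sq_nonneg ε) (sq_nonneg D)]
      _ ≤ (1-ε/2) * W := by apply mul_le_mul_of_nonneg_left c2; linarith
      _ ≤ f2 * W := by apply mul_le_mul_of_nonneg_right _ c0; linarith
  have k2 : f2 * W ≤ (1+ε) * D^2 := by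
    calc f2 * W ≤ (1+ε) * W := by apply mul_le_mul_of_nonneg_right _ c0; linarith
      _ ≤ _ := by apply mul_le_mul_of_nonneg_left c1; linarith
  have k3 : (1-ε) * X ≤ X * f1 := by rw [mul_comm]; apply mul_le_mul_of_nonneg_left _ hX; linarith
  have k4 : X * f1 ≤ (1+ε) * X := by rw [mul_comm (1+ε)]; apply mul_le_mul_of_nonneg_left _ hX; linarith
  have k5 := mul_le_mul_of_nonneg_left k1 hA.le
  have k6 := mul_le_mul_of_nonneg_left k2 hA.le
  constructor <;> nlinarith

lemma icoD (base t : ℝ) (ht : 0 ≤ t) (k l : ℕ) (hkl : k ≠ l) :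
    Disjoint (Ico (base + k * t) (base + k * t + t)) (Ico (base + l * t) (base + l * t + t)) := by
  rw [Set.disjoint_left]
  rintro x ⟨h1, h2⟩ ⟨h3, h4⟩
  rcases lt_or_gt_of_ne hkl with h | h
  · have : (k:ℝ) + 1 ≤ l := by exact_mod_cast h
    nlinarith
  · have : (l:ℝ) + 1 ≤ k := by exact_mod_cast h
    nlinarith

lemma floor_mul (x y : ℝ) (hx : 0 ≤ x) (hy : 0 ≤ y) : x * y - x - y ≤ (⌊x⌋₊ : ℝ) * ⌊y⌋₊ := by
  have h1 := (Nat.lt_floor_add_one x).le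
  have h2 := (Nat.lt_floor_add_one y).le
  have h3 : (0:ℝ) ≤ ⌊x⌋₊ := by positivity
  have h4 : (0:ℝ) ≤ ⌊y⌋₊ := by positivity
  have h5 := Nat.floor_le hx
  have h6 := Nat.floor_le hy
  nlinarith [mul_nonneg (sub_nonneg.mpr h1) hy, mul_nonneg (sub_nonneg.mpr h2) h3]

theorem grid (m : ℕ) (hm : 0 < m) (η ε : ℝ) (h0 : 0 < η) (h1 : η < 1) (hε : 0 < ε) (hε1 : ε < 1) :
    ∃ h0 > 0, ∀ h : ℝ, 0 < h → h < h0 →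
      ∃ (C : Type) (_ : Fintype C) (_ : DecidableEq C) (zc fc rc : C → ℝ), (∀ c, 0 < rc c) ∧
      (∀ c, Qset m h (zc c) (fc c) (rc c) ⊆ RR) ∧
      (Pairwise (fun c c' => Disjoint (Qset m h (zc c) (fc c) (rc c)) (Qset m h (zc c') (fc c') (rc c')))) ∧
      (∀ c, ∀ p ∈ Sq m, ∀ q ∈ Sq m, (1-ε) * h^2 * D2 p q ≤
        2 - 2 * inner ℝ (PP (Amap h (zc c) (fc c) (rc c) p)) (PP (Amap h (zc c) (fc c) (rc c) q))) ∧
      (∀ c, ∀ p ∈ Sq m, ∀ q ∈ Sq m,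
        2 - 2 * inner ℝ (PP (Amap h (zc c) (fc c) (rc c) p)) (PP (Amap h (zc c) (fc c) (rc c) q)) ≤ (1+ε) * h^2 * D2 p q) ∧
      4*π*(1-2*η) ≤ (Fintype.card C : ℝ) * m^2 * h^2 := by
  obtain ⟨δ, hδ, hgeo⟩ := geo η ε h0 h1 hε hε1
  obtain ⟨n, hn⟩ := exists_nat_gt (2*(1-η)/δ)
  have hη1 : 0 < 1 - η := by linarith
  have hn0 : (0:ℝ) < n := lt_of_le_of_lt (by positivity) hn
  have hm' : (0:ℝ) < m := by exact_mod_cast hm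
  have hpi := Real.pi_pos
  obtain ⟨w, hw⟩ : ∃ w, w = 2*(1-η)/n := ⟨_, rfl⟩
  have hw0 : 0 < w := by rw [hw]; positivity
  have hwδ : w < δ := by
    rw [hw, div_lt_iff₀ hn0]; rw [div_lt_iff₀ hδ] at hn; linarith
  have hnw : n * w = 2*(1-η) := by rw [hw]; field_simp
  have hsη : 0 < √η := Real.sqrt_pos.mpr h0
  refine ⟨min (δ * √η / m) (4*π*η/(m*n*(w/√η + 2*π))), by positivity, ?_⟩
  intro h hh hlt
  rw [lt_min_iff] at hlt
  obtain ⟨hlt1, hlt2⟩ := hlt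
  rw [lt_div_iff₀ (by positivity)] at hlt1 hlt2
  let Z : Fin n → ℝ := fun a => -(1-η) + (a:ℕ) * w
  have hZ : ∀ a, -(1-η) ≤ Z a ∧ Z a + w ≤ 1 - η := by
    intro a
    have h3 : ((a:ℕ):ℝ) + 1 ≤ n := by exact_mod_cast a.2
    have h4 : (0:ℝ) ≤ ((a:ℕ):ℝ) := by positivity
    constructor
    · simp only [Z]; nlinarith
    · simp only [Z]; nlinarith
  have hZm : ∀ a, Z a ∈ Icc (-(1-η)) (1-η) := fun a => ⟨(hZ a).1, by linarith [(hZ a).2]⟩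
  let ρ : Fin n → ℝ := fun a => √(1 - (Z a)^2)
  have hρη : ∀ a, √η ≤ ρ a := fun a => Real.sqrt_le_sqrt (one_sub_ge η _ h0 h1 (hZm a))
  have hρ : ∀ a, 0 < ρ a := fun a => lt_of_lt_of_le hsη (hρη a)
  have hρ1 : ∀ a, ρ a ≤ 1 := fun a => Real.sqrt_le_one.mpr (by nlinarith [sq_nonneg (Z a)])
  have hρ2 : ∀ a, (ρ a)^2 = 1 - (Z a)^2 := fun a => Real.sq_sqrt (h0.le.trans (one_sub_ge η _ h0 h1 (hZm a)))
  let P : Fin n → ℕ := fun a => ⌊w / (h * ρ a * m)⌋₊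
  let K : Fin n → ℕ := fun a => ⌊2*π / (h / ρ a * m)⌋₊
  have hP : ∀ a, (P a : ℝ) * (h * ρ a * m) ≤ w := by
    intro a
    have := hρ a
    rw [← le_div_iff₀ (by positivity)]
    exact Nat.floor_le (by positivity)
  have hK : ∀ a, (K a : ℝ) * (h / ρ a * m) ≤ 2*π := by
    intro a
    have := hρ a
    rw [← le_div_iff₀ (by positivity)]
    exact Nat.floor_le (by positivity)
  have hzr : ∀ (a : Fin n) (k : Fin (P a)), Ico (Z a + (k:ℕ) * (h * ρ a * m)) (Z a + (k:ℕ) * (h * ρ a * m) + h * ρ a * m) ⊆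
      Ico (Z a) (Z a + w) := by
    intro a k
    have h3 : ((k:ℕ):ℝ) + 1 ≤ P a := by exact_mod_cast k.2
    have h4 : (0:ℝ) ≤ ((k:ℕ):ℝ) := by positivity
    have := hρ a
    have h5 : 0 < h * ρ a * m := by positivity
    apply Ico_subset_Ico
    · nlinarith
    · nlinarith [hP a]
  refine ⟨Σ a : Fin n, Fin (P a) × Fin (K a), inferInstance, inferInstance,
    fun c => Z c.1 + (c.2.1:ℕ) * (h * ρ c.1 * m), fun c => -π + (c.2.2:ℕ) * (h / ρ c.1 * m), fun c => ρ c.1,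
    fun c => hρ _, ?_, ?_, ?_, ?_, ?_⟩
  · rintro ⟨a, k, l⟩
    apply prod_mono
    · refine (hzr a k).trans (Ico_subset_Ico ?_ ?_)
      · linarith [(hZ a).1]
      · linarith [(hZ a).2]
    · have h3 : ((l:ℕ):ℝ) + 1 ≤ K a := by exact_mod_cast l.2
      have h4 : (0:ℝ) ≤ ((l:ℕ):ℝ) := by positivity
      have := hρ a
      have h5 : 0 < h / ρ a * m := by positivity
      apply Ico_subset_Ico
      · simp only; nlinarith
      · simp only; nlinarith [hK a]
  · rintro ⟨a, k, l⟩ ⟨a', k', l'⟩ hne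
    unfold Qset
    rw [Set.disjoint_prod]
    by_cases haa : a = a'
    · subst haa
      have := hρ a
      by_cases hkk : k = k'
      · subst hkk
        right
        apply icoD _ _ (by positivity)
        intro hll
        apply hne
        have hll' : l = l' := Fin.val_injective hll
        rw [hll']
      · left
        apply icoD _ _ (by positivity)
        intro hkk'
        exact hkk (Fin.val_injective hkk')
    · left
      refine Set.disjoint_of_subset (hzr a k) (hzr a' k') ?_
      apply icoD _ _ hw0.le
      intro h3
      exact haa (Fin.val_injective h3)
  all_goals
    have key : ∀ c : (Σ a : Fin n, Fin (P a) × Fin (K a)), ∀ p ∈ Sq m, ∀ q ∈ Sq m,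
      (1-ε) * h^2 * D2 p q ≤
        2 - 2 * inner ℝ (PP (Amap h (Z c.1 + (c.2.1:ℕ) * (h * ρ c.1 * m)) (-π + (c.2.2:ℕ) * (h / ρ c.1 * m)) (ρ c.1) p))
          (PP (Amap h (Z c.1 + (c.2.1:ℕ) * (h * ρ c.1 * m)) (-π + (c.2.2:ℕ) * (h / ρ c.1 * m)) (ρ c.1) q)) ∧
      2 - 2 * inner ℝ (PP (Amap h (Z c.1 + (c.2.1:ℕ) * (h * ρ c.1 * m)) (-π + (c.2.2:ℕ) * (h / ρ c.1 * m)) (ρ c.1) p))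
          (PP (Amap h (Z c.1 + (c.2.1:ℕ) * (h * ρ c.1 * m)) (-π + (c.2.2:ℕ) * (h / ρ c.1 * m)) (ρ c.1) q)) ≤
        (1+ε) * h^2 * D2 p q := by
      rintro ⟨a, k, l⟩ p hp q hq
      have hr := hρ a
      have hb := hzr a k (A_mem m h (Z a + (k:ℕ) * (h * ρ a * m)) (-π + (l:ℕ) * (h / ρ a * m)) (ρ a) hh hr p hp).1
      have hc := hzr a k (A_mem m h (Z a + (k:ℕ) * (h * ρ a * m)) (-π + (l:ℕ) * (h / ρ a * m)) (ρ a) hh hr q hq).1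
      have hZa := hZ a
      have e1 : (h * ρ a * p.1 - h * ρ a * q.1)^2/(1-(Z a)^2) + (1-(Z a)^2)*(h / ρ a * p.2 - h / ρ a * q.2)^2 = h^2 * D2 p q := by
        rw [← hρ2 a]; unfold D2; field_simp
      have hφ : |h / ρ a * p.2 - h / ρ a * q.2| < δ := by
        rw [← mul_sub, abs_mul, abs_of_pos (by positivity : 0 < h / ρ a)]
        have : |p.2 - q.2| ≤ m := by
          rw [abs_le]; constructor <;> linarith [hp.2.1, hp.2.2, hq.2.1, hq.2.2]
        calc h / ρ a * |p.2 - q.2| ≤ h / √η * m := by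
              apply mul_le_mul _ this (abs_nonneg _) (by positivity)
              exact div_le_div_of_nonneg_left hh.le hsη (hρη a)
          _ < δ := by rw [div_mul_eq_mul_div, div_lt_iff₀ hsη]; exact hlt1
      simp only [Amap] at hb hc ⊢
      have := hgeo (Z a) (hZm a) _ ⟨hZa.1.trans hb.1, hb.2.le.trans hZa.2⟩ _ ⟨hZa.1.trans hc.1, hc.2.le.trans hZa.2⟩
        (-π + (l:ℕ) * (h / ρ a * m) + h / ρ a * p.2) (-π + (l:ℕ) * (h / ρ a * m) + h / ρ a * q.2)
        (by rw [abs_lt]; constructor <;> linarith [hb.1, hb.2])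
        (by rw [abs_lt]; constructor <;> linarith [hc.1, hc.2])
        (by rwa [add_sub_add_left_eq_sub])
      rw [add_sub_add_left_eq_sub, add_sub_add_left_eq_sub, e1] at this
      rwa [mul_assoc (1-ε), mul_assoc (1+ε)]
  · exact fun c p hp q hq => (key c p hp q hq).1
  · exact fun c p hp q hq => (key c p hp q hq).2
  · have hcell : ∀ a, 2*π*w - m*h*(w/√η + 2*π) ≤ ((P a * K a : ℕ) : ℝ) * m^2 * h^2 := by
      intro a
      have hr := hρ a
      have := floor_mul (w / (h * ρ a * m)) (2*π / (h / ρ a * m)) (by positivity) (by positivity)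
      have h3 := mul_le_mul_of_nonneg_right this (by positivity : 0 ≤ (m:ℝ)^2 * h^2)
      have h4 : (w / (h * ρ a * m) * (2*π / (h / ρ a * m)) - w / (h * ρ a * m) - 2*π / (h / ρ a * m)) * ((m:ℝ)^2 * h^2) =
          2*π*w - m*h*(w/ρ a + 2*π*ρ a) := by field_simp; ring
      rw [h4] at h3
      push_cast
      refine le_trans ?_ (h3.trans (le_of_eq (by ring)))
      have h5 : w / ρ a ≤ w / √η := div_le_div_of_nonneg_left hw0.le hsη (hρη a)
      have h6 : 2*π*ρ a ≤ 2*π := by nlinarith [hρ1 a]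
      have h7 : 0 < m * h := by positivity
      have h8 := mul_le_mul_of_nonneg_left (add_le_add h5 h6) h7.le
      linarith
    have hcard : Fintype.card (Σ a : Fin n, Fin (P a) × Fin (K a)) = ∑ a, P a * K a := by
      simp [Fintype.card_sigma]
    rw [hcard]
    push_cast
    rw [Finset.sum_mul, Finset.sum_mul]
    have h3 : ∑ a : Fin n, (2*π*w - m*h*(w/√η + 2*π)) ≤ ∑ a : Fin n, ((P a:ℝ) * K a) * m^2 * h^2 :=
      Finset.sum_le_sum (fun a _ => by have := hcell a; push_cast at this; exact this)
    refine le_trans ?_ h3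
    rw [Finset.sum_const, Finset.card_univ, Fintype.card_fin, nsmul_eq_mul]
    have h9 : (n:ℝ) * (2*π*w - m*h*(w/√η + 2*π)) = 2*π*(n*w) - h * (m*n*(w/√η + 2*π)) := by ring
    rw [h9, hnw]
    linarith

end RB

namespace RB
open MeasureTheory
open Set

lemma C_lower (z : ℝ) (hz : 0 < z) (hz1 : z < 1) : -((4:ℝ)^(-z) * TT z) ≤ Cconst (2*z) := by
  have hzeta := zeta_lower z hz hz1
  unfold Cconst TT
  have e1 : 2*z/2 = z := by ring
  have e2 : (2:ℝ)^(-(2*z)) = 4^(-z) := by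
    rw [show -(2*z) = 2 * (-z) by ring, Real.rpow_mul (by norm_num)]; norm_num
  rw [e1, e2]
  have hG : 0 < Gamma (1-z) := Real.Gamma_pos_of_pos (by linarith)
  have h4 : (0:ℝ) < 4^(-z) := by positivity
  have hp : 0 ≤ (4:ℝ)^(-z) * z * (1+z) * Gamma (1-z) := by positivity
  have := mul_le_mul_of_nonneg_left hzeta hp
  refine le_trans (le_of_eq ?_) this
  field_simp

lemma choose_eps (z A B R : ℝ) (h : R < A - B) :
    ∃ ε : ℝ, 0 < ε ∧ ε < 1/4 ∧ R < (1-2*ε) * ((1+ε)^(-z) * A - (1-ε)^(-z) * B) := by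
  have hc : ContinuousAt (fun ε : ℝ => (1-2*ε) * ((1+ε)^(-z) * A - (1-ε)^(-z) * B)) 0 := by
    have c1 : ContinuousAt (fun ε : ℝ => (1+ε)^(-z)) 0 :=
      ContinuousAt.rpow_const (by fun_prop) (Or.inl (by norm_num))
    have c2 : ContinuousAt (fun ε : ℝ => (1-ε)^(-z)) 0 :=
      ContinuousAt.rpow_const (by fun_prop) (Or.inl (by norm_num))
    exact ContinuousAt.mul (by fun_prop) ((c1.mul continuousAt_const).sub (c2.mul continuousAt_const))
  have h1 : ∀ᶠ ε in nhds (0:ℝ), R < (1-2*ε) * ((1+ε)^(-z) * A - (1-ε)^(-z) * B) := by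
    apply hc.eventually_const_lt
    simpa using h
  have h2 : ∀ᶠ ε in nhds (0:ℝ), ε < 1/4 := by
    exact eventually_lt_nhds (by norm_num)
  have h3 : ∀ᶠ ε in nhdsWithin (0:ℝ) (Ioi 0), 0 < ε := eventually_mem_nhdsWithin
  obtain ⟨ε, ⟨a, b⟩, c⟩ := (((h1.and h2).filter_mono nhdsWithin_le_nhds).and h3).exists
  exact ⟨ε, c, b, a⟩

lemma to_real {N : ℕ} (z : ℝ) (hz : 0 < z) (x : Fin N → E3) (hx : ∀ i, ‖x i‖ = 1) (K : ENNReal) (hK : K ≠ ⊤)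
    (hle : ∑ i, ∑ j, (if i = j then 0 else (ENNReal.ofReal (2 - 2 * inner ℝ (x i) (x j)))^(-z)) ≤ K) :
    Function.Injective x ∧ ENNReal.ofReal (∑ i : Fin N, ∑ j : Fin N, (if i = j then 0 else ‖x i - x j‖ ^ (-(2*z)))) =
      ∑ i, ∑ j, (if i = j then 0 else (ENNReal.ofReal (2 - 2 * inner ℝ (x i) (x j)))^(-z)) := by
  have hn : ∀ i j, 2 - 2 * inner ℝ (x i) (x j) = ‖x i - x j‖^2 := by
    intro i j
    rw [@norm_sub_sq_real, hx, hx]; ring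
  have hinj : Function.Injective x := by
    intro i j hij
    by_contra hne
    have h1 := hn i j
    rw [hij, sub_self, norm_zero] at h1
    have h2 : (if i = j then 0 else (ENNReal.ofReal (2 - 2 * inner ℝ (x i) (x j)))^(-z)) ≤ K := by
      refine le_trans ?_ hle
      refine le_trans ?_ (Finset.single_le_sum (fun _ _ => zero_le) (Finset.mem_univ i))
      exact Finset.single_le_sum (f := fun j => (if i = j then 0 else (ENNReal.ofReal (2 - 2 * inner ℝ (x i) (x j)))^(-z))) (fun _ _ => zero_le) (Finset.mem_univ j)
    rw [if_neg hne, hij, h1] at h2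
    simp [ENNReal.zero_rpow_of_neg (neg_lt_zero.mpr hz)] at h2
    exact hK h2
  refine ⟨hinj, ?_⟩
  rw [ENNReal.ofReal_sum_of_nonneg (fun i _ => Finset.sum_nonneg (fun j _ => by split_ifs <;> positivity))]
  refine Finset.sum_congr rfl (fun i _ => ?_)
  rw [ENNReal.ofReal_sum_of_nonneg (fun j _ => by split_ifs <;> positivity)]
  refine Finset.sum_congr rfl (fun j _ => ?_)
  split_ifs with hij
  · simp
  · have hpos : 0 < ‖x i - x j‖ := by
      rw [norm_pos_iff, sub_ne_zero]
      exact fun hh => hij (hinj hh)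
    rw [hn, ENNReal.ofReal_rpow_of_pos (by positivity)]
    congr 1
    rw [show -(2*z) = 2 * (-z) by ring, Real.rpow_mul hpos.le]
    norm_num

set_option maxHeartbeats 1000000 in
theorem main (z : ℝ) (hz : 0 < z) (hz1 : z < 1) :
    ∃ N₀ : ℕ, ∀ N : ℕ, N₀ ≤ N →
      (∃ x : Fin N → EuclideanSpace ℝ (Fin 3),
        (∀ i, ‖x i‖ = 1) ∧ Function.Injective x ∧
        ∑ i : Fin N, ∑ j : Fin N, (if i = j then 0 else ‖x i - x j‖ ^ (-(2*z))) ≤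
          2 ^ (1-2*z) / (2-2*z) * (N:ℝ)^2 - 4^(-z) * TT z * (N:ℝ) ^ (1 + z)) := by
  obtain ⟨m, hm, hloc⟩ := local_main z hz hz1
  have hT := TT_pos z hz hz1
  have hB := BB_nonneg z m
  have hpi := Real.pi_pos
  obtain ⟨A, hA0, hA1, hA2⟩ := ENNReal.lt_iff_exists_real_btwn.mp hloc
  have hA3 := (ENNReal.ofReal_lt_ofReal_iff_of_nonneg (by positivity)).mp hA1
  obtain ⟨ε, hε, hε4, hR⟩ := choose_eps z A (BB z m) ((m:ℝ)^2 * π^z * TT z) (by linarith)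
  obtain ⟨h0, hh0, hgrid⟩ := grid m hm ε ε hε (by linarith) hε (by linarith)
  obtain ⟨N₀, hN₀⟩ := exists_nat_gt (4*π/h0^2)
  refine ⟨N₀ + 1, fun N hN => ?_⟩
  have hNpos : 0 < N := by omega
  have hNr : (0:ℝ) < N := by exact_mod_cast hNpos
  obtain ⟨h, hh⟩ : ∃ h, h = √(4*π/N) := ⟨_, rfl⟩
  have hpos : 0 < h := by rw [hh]; positivity
  have hsq : h^2 = 4*π/N := by rw [hh]; exact Real.sq_sqrt (by positivity)
  have hlt : h < h0 := by
    rw [hh, Real.sqrt_lt' hh0, div_lt_iff₀ hNr]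
    rw [div_lt_iff₀ (by positivity)] at hN₀
    have : (N₀:ℝ) ≤ N := by exact_mod_cast (by omega : N₀ ≤ N)
    nlinarith [sq_nonneg h0]
  obtain ⟨C, iF, iD, zc, fc, rc, g1, g2, g3, g4, g5, g6⟩ := hgrid h hpos hlt
  obtain ⟨x, hx, hle⟩ := exists_configuration z hz hz1 m N hm hNpos h ε hpos hsq hε (by linarith) zc fc rc g1 g2 g3 g4 g5
  obtain ⟨M, hM⟩ : ∃ M, M = Fintype.card C := ⟨_, rfl⟩
  rw [← hM] at hle g6
  have hz2 : 0 < 2 - 2*z := by linarith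
  have hε1 : 0 < 1 - ε := by linarith
  set c0 : ℝ := 2 ^ (1-2*z) / (2-2*z) with hc0
  have hc0' : 0 ≤ c0 := by positivity
  set E := ∑ i, ∑ j, (if i = j then 0 else (ENNReal.ofReal (2 - 2 * inner ℝ (x i) (x j)))^(-z)) with hE
  have hle2 : E + ENNReal.ofReal (M * (((1+ε)*h^2)^(-z) * A)) ≤
      ENNReal.ofReal (c0 * (N:ℝ)^2 + M * (((1-ε)*h^2)^(-z) * BB z m)) := by
    rw [ENNReal.ofReal_add (by positivity) (by positivity), ENNReal.ofReal_mul (p := (M:ℝ)) (by positivity),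
      ENNReal.ofReal_mul (p := (M:ℝ)) (by positivity), ENNReal.ofReal_natCast, ENNReal.ofReal_mul (p := ((1+ε)*h^2)^(-z)) (by positivity)]
    refine le_trans ?_ hle
    gcongr
  obtain ⟨hinj, hEr⟩ := to_real z hz x hx _ ENNReal.ofReal_ne_top (le_self_add.trans hle2)
  refine ⟨x, hx, hinj, ?_⟩
  rw [← hE] at hEr
  rw [← hEr, ← ENNReal.ofReal_add (Finset.sum_nonneg (fun i _ => Finset.sum_nonneg (fun j _ => by split_ifs <;> positivity))) (by positivity),
    ENNReal.ofReal_le_ofReal_iff (by positivity)] at hle2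
  have key : 4^(-z) * TT z * (N:ℝ)^(1+z) ≤ M * (((1+ε)*h^2)^(-z) * A) - M * (((1-ε)*h^2)^(-z) * BB z m) := by
    rw [Real.mul_rpow (by positivity) (by positivity), Real.mul_rpow (by positivity) (by positivity)]
    set br := (1+ε)^(-z) * A - (1-ε)^(-z) * BB z m with hbr
    have e1 : M * ((1+ε)^(-z) * (h^2)^(-z) * A) - M * ((1-ε)^(-z) * (h^2)^(-z) * BB z m) = M * (h^2)^(-z) * br := by
      rw [hbr]; ring
    rw [e1]
    have hm' : (0:ℝ) < m := by exact_mod_cast hm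
    have hRpos : 0 < (m:ℝ)^2 * π^z * TT z := by positivity
    have h2ε : 0 < 1 - 2*ε := by linarith
    have hbrp : 0 < br := by
      by_contra hcon
      push Not at hcon
      have := mul_nonpos_of_nonneg_of_nonpos h2ε.le hcon
      linarith
    have hMm : (1-2*ε) * N ≤ M * m^2 := by
      rw [hsq, mul_div_assoc', le_div_iff₀ hNr] at g6
      have h7 : (4*π) * ((1-2*ε) * N) ≤ (4*π) * (M * m^2) := by linarith
      exact le_of_mul_le_mul_left h7 (by positivity)
    have e2 : (h^2)^(-z) = 4^(-z) * (π^z)⁻¹ * (N:ℝ)^z := by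
      rw [hsq, Real.div_rpow (by positivity) (by positivity), Real.mul_rpow (by norm_num) hpi.le, Real.rpow_neg hpi.le,
        Real.rpow_neg hNr.le, div_inv_eq_mul]
    rw [e2, Real.rpow_add hNr, Real.rpow_one]
    have hpz : 0 < π^z := by positivity
    have s1 : (m:ℝ)^2 * π^z * TT z * N ≤ M * m^2 * br := by
      calc (m:ℝ)^2 * π^z * TT z * N ≤ (1-2*ε) * br * N := by gcongr
        _ = (1-2*ε) * N * br := by ring
        _ ≤ _ := by gcongr
    have s2 : π^z * TT z * N ≤ M * br := by
      have : 0 < (m:ℝ)^2 := by positivity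
      refine le_of_mul_le_mul_left ?_ this
      calc (m:ℝ)^2 * (π^z * TT z * N) = (m:ℝ)^2 * π^z * TT z * N := by ring
        _ ≤ M * m^2 * br := s1
        _ = _ := by ring
    calc (4:ℝ)^(-z) * TT z * (N * (N:ℝ)^z) = 4^(-z) * (π^z)⁻¹ * (N:ℝ)^z * (π^z * TT z * N) := by field_simp
      _ ≤ 4^(-z) * (π^z)⁻¹ * (N:ℝ)^z * (M * br) := by gcongr
      _ = _ := by ring
  linarith

end RB

/-- For `0 < s < 2` there is `N₀` such that for all `N ≥ N₀` there are `N` distinct points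
on `S²` with Riesz `s`-energy at most `(2^{1−s}/(2−s))N² + C(s)N^{1+s/2}`; in particular
the minimal Riesz `s`-energy satisfies the same bound. -/
theorem minimal_riesz_energy_bound (s : ℝ) (hs0 : 0 < s) (hs2 : s < 2) :
    ∃ N₀ : ℕ, ∀ N : ℕ, N₀ ≤ N →
      (∃ x : Fin N → EuclideanSpace ℝ (Fin 3),
        (∀ i, ‖x i‖ = 1) ∧ Function.Injective x ∧
        ∑ i : Fin N, ∑ j : Fin N, (if i = j then 0 else ‖x i - x j‖ ^ (-s)) ≤
          2 ^ (1-s) / (2-s) * (N:ℝ)^2 + Cconst s * (N:ℝ) ^ (1 + s/2)) ∧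
      sInf (rieszEnergies s N) ≤
        2 ^ (1-s) / (2-s) * (N:ℝ)^2 + Cconst s * (N:ℝ) ^ (1 + s/2) := by
  obtain ⟨z, rfl⟩ : ∃ z, s = 2*z := ⟨s/2, by ring⟩
  have hz : 0 < z := by linarith
  have hz1 : z < 1 := by linarith
  obtain ⟨N₀, h⟩ := RB.main z hz hz1
  refine ⟨N₀, fun N hN => ?_⟩
  obtain ⟨x, hx, hinj, hle⟩ := h N hN
  have hC := RB.C_lower z hz hz1
  have e : 2*z/2 = z := by ring
  have hNz : (0:ℝ) ≤ (N:ℝ)^(1+z) := by positivity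
  have h1 := mul_le_mul_of_nonneg_right hC hNz
  have hle2 : ∑ i : Fin N, ∑ j : Fin N, (if i = j then 0 else ‖x i - x j‖ ^ (-(2*z))) ≤
          2 ^ (1-2*z) / (2-2*z) * (N:ℝ)^2 + Cconst (2*z) * (N:ℝ) ^ (1 + 2*z/2) := by
    rw [e]; linarith
  refine ⟨⟨x, hx, hinj, hle2⟩, le_trans (csInf_le ?_ ⟨x, hx, hinj, rfl⟩) hle2⟩
  refine ⟨0, ?_⟩
  rintro _ ⟨y, _, _, rfl⟩
  refine Finset.sum_nonneg (fun i _ => Finset.sum_nonneg (fun j _ => ?_))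
  split_ifs <;> positivity
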